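/- arXiv:2312.02687 — 2 statements merged into one kernel-verified Lean document; each statement's English description precedes it below -/
import Mathlib

section
/- Let U ⊆ [n] be any subset and G a graph on [n]. Then the symbolic and ordinary powers of the prime ideal P_U(G) coincide: P_U(G)^(t) = P_U(G)^t for every integer t ≥ 1. -/
open MvPolynomial

/-- The `t`-th symbolic power of an ideal `I`: the intersection, over all minimal primes `p`
of `I`, of the contraction to `S` of the extension of `I ^ t` to the localization `S_p`. -/
noncomputable def symbolicPower {S : Type*} [CommRing S] (I : Ideal S) (t : ℕ) : Ideal S :=
  ⨅ (p : Ideal S) (hp : p ∈ I.minimalPrimes),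
    haveI : p.IsPrime := hp.1.1
    (Ideal.map (algebraMap S (Localization.AtPrime p)) (I ^ t)).comap
      (algebraMap S (Localization.AtPrime p))

/-- For `U ⊆ [n]`, the prime ideal `P_U(G)`: generated by the variables `x_i, y_i` for
`i ∈ U` together with the binomials `x_i y_j - x_j y_i` for all pairs of distinct vertices
`i, j ∉ U` lying in the same connected component of the induced subgraph of `G` on the
complement of `U`. -/
noncomputable def PUIdeal (k : Type) [Field k] {n : ℕ} (G : SimpleGraph (Fin n))
    (U : Set (Fin n)) : Ideal (MvPolynomial (Fin n ⊕ Fin n) k) :=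
  Ideal.span
    ({f | ∃ i ∈ U, f = X (Sum.inl i) ∨ f = X (Sum.inr i)} ∪
     {f | ∃ (i j : Fin n) (hi : i ∈ Uᶜ) (hj : j ∈ Uᶜ),
        (G.induce Uᶜ).Reachable ⟨i, hi⟩ ⟨j, hj⟩ ∧ i ≠ j ∧
        f = X (Sum.inl i) * X (Sum.inr j) - X (Sum.inl j) * X (Sum.inr i)})

/-! ### Leading monomials with respect to an integral weight -/

/-- The monomial with exponent `e` occurs in `g` with coefficient `1`, and every other monomial
of `g` has strictly smaller weight. -/
def HasLead {σ R : Type*} [CommRing R] (w : σ → ℤ) (g : MvPolynomial σ R) (e : σ →₀ ℕ) : Prop :=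
  coeff e g = 1 ∧ ∀ e', coeff e' g ≠ 0 → e' = e ∨ Finsupp.weight w e' < Finsupp.weight w e

namespace HasLead

variable {σ R : Type*} [CommRing R] {w : σ → ℤ}

theorem monomial_one (w : σ → ℤ) (e : σ →₀ ℕ) : HasLead w (monomial e (1 : R)) e := by
  classical
  refine ⟨by simp, fun e' h => Or.inl ?_⟩
  by_contra hne
  exact h (by rw [coeff_monomial, if_neg (Ne.symm hne)])

theorem monomial_add {e e' : σ →₀ ℕ} (h : Finsupp.weight w e' < Finsupp.weight w e) (a : R) :
    HasLead w (monomial e 1 + monomial e' a) e := by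
  classical
  have hne : e' ≠ e := by rintro rfl; exact lt_irrefl _ h
  refine ⟨by simp [coeff_monomial, hne], fun e'' h'' => ?_⟩
  by_cases h1 : e = e''
  · exact Or.inl h1.symm
  · by_cases h2 : e' = e''
    · exact Or.inr (h2 ▸ h)
    · simp [coeff_monomial, h1, h2] at h''

theorem mul {g h : MvPolynomial σ R} {e e' : σ →₀ ℕ} (hg : HasLead w g e) (hh : HasLead w h e') :
    HasLead w (g * h) (e + e') := by
  classical
  constructor
  · rw [coeff_mul, Finset.sum_eq_single (e, e')]
    · rw [hg.1, hh.1, one_mul]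
    · rintro ⟨a, b⟩ hab hne
      by_contra hmul
      have hsum : a + b = e + e' := Finset.HasAntidiagonal.mem_antidiagonal.mp hab
      have hwt := congrArg (Finsupp.weight w) hsum
      simp only [map_add] at hwt
      rcases hg.2 a (left_ne_zero_of_mul hmul) with rfl | ha <;>
        rcases hh.2 b (right_ne_zero_of_mul hmul) with rfl | hb
      · exact hne rfl
      all_goals linarith
    · intro hn
      simp at hn
  · intro d hd
    rw [coeff_mul] at hd
    obtain ⟨⟨a, b⟩, hab, hmul⟩ := Finset.exists_ne_zero_of_sum_ne_zero hd
    obtain rfl : a + b = d := Finset.HasAntidiagonal.mem_antidiagonal.mp hab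
    simp only [map_add]
    rcases hg.2 a (left_ne_zero_of_mul hmul) with rfl | ha <;>
      rcases hh.2 b (right_ne_zero_of_mul hmul) with rfl | hb
    · exact Or.inl rfl
    all_goals right; linarith

theorem pow {g : MvPolynomial σ R} {e : σ →₀ ℕ} (hg : HasLead w g e) (r : ℕ) :
    HasLead w (g ^ r) (r • e) := by
  induction r with
  | zero => simpa using monomial_one (R := R) w 0
  | succ r ih => simpa [pow_succ, add_smul] using ih.mul hg

/-- If `φ` sends each variable to a polynomial with a leading monomial, then it sends each
monomial to a polynomial with the corresponding product as leading monomial. -/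
theorem map_monomial {τ : Type*} {w' : τ → ℤ} (φ : MvPolynomial σ R →ₐ[R] MvPolynomial τ R)
    (E : σ → τ →₀ ℕ) (h : ∀ v, HasLead w' (φ (X v)) (E v)) (m : σ →₀ ℕ) :
    HasLead w' (φ (monomial m 1)) (Finsupp.weight E m) := by
  induction m using Finsupp.induction_linear with
  | zero => simpa using monomial_one (R := R) w' 0
  | add a b ha hb =>
    rw [map_add, show monomial (a + b) (1 : R) = monomial a 1 * monomial b 1 by simp, map_mul]
    exact ha.mul hb
  | single v r =>
    rw [Finsupp.weight_single, ← X_pow_eq_monomial, map_pow]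
    exact (h v).pow r

/-- A monomial of maximal weight in `f` gives rise to a monomial of the image of `f`, provided
that distinct monomials have distinct leading monomials of the same weight in the target. -/
theorem coeff_map {τ : Type*} {w' : τ → ℤ} (φ : MvPolynomial σ R →ₐ[R] MvPolynomial τ R)
    (E : σ → τ →₀ ℕ) (h : ∀ v, HasLead w' (φ (X v)) (E v))
    (hw : ∀ v, Finsupp.weight w' (E v) = w v) (hE : Function.Injective (Finsupp.weight (R := ℕ) E))
    (f : MvPolynomial σ R) (m : σ →₀ ℕ)
    (hm : ∀ m', coeff m' f ≠ 0 → Finsupp.weight w m' ≤ Finsupp.weight w m) :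
    coeff (Finsupp.weight E m) (φ f) = coeff m f := by
  classical
  have hweight : ∀ a : σ →₀ ℕ, Finsupp.weight w' (Finsupp.weight E a) = Finsupp.weight w a := by
    intro a
    induction a using Finsupp.induction_linear with
    | zero => simp
    | add a b ha hb => simp [ha, hb]
    | single v r => simp [Finsupp.weight_single, hw]
  have hf : φ f = ∑ a ∈ f.support, coeff a f • φ (monomial a 1) := by
    conv_lhs => rw [f.as_sum]
    rw [map_sum]
    refine Finset.sum_congr rfl fun a _ => ?_
    rw [← map_smul, smul_monomial, smul_eq_mul, mul_one]
  rw [hf, coeff_sum, Finset.sum_eq_single m]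
  · rw [coeff_smul, (map_monomial φ E h m).1, smul_eq_mul, mul_one]
  · intro a ha hne
    rw [coeff_smul, smul_eq_mul]
    by_contra hmul
    rcases (map_monomial φ E h a).2 _ (right_ne_zero_of_mul hmul) with heq | hlt
    · exact hne (hE heq).symm
    · rw [hweight, hweight] at hlt
      exact absurd (hm a (mem_support_iff.mp ha)) (not_le.mpr hlt)
  · intro hn
    rw [notMem_support_iff.mp hn, zero_smul, coeff_zero]

end HasLead

theorem MvPolynomial.le_of_X_pow_dvd {σ R : Type*} [CommRing R] {g : MvPolynomial σ R} {i : σ}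
    {t : ℕ} (h : X i ^ t ∣ g) {e : σ →₀ ℕ} (he : coeff e g ≠ 0) : t ≤ e i := by
  classical
  obtain ⟨q, rfl⟩ := h
  rw [X_pow_eq_monomial, coeff_monomial_mul'] at he
  by_contra hlt
  exact he (if_neg fun hle => hlt (by simpa using hle i))

/-! ### Ideals generated by variables and 2-minors of generic matrices in disjoint variables -/

namespace MinorIdeal

variable {n : ℕ} {C : Type}

/-- The ideal generated by the variables `x_i, y_i` with `i ∈ U` and the minors of the columns
`i, j ∉ U` lying in the same block `comp i = comp j`. -/
noncomputable def minorIdeal (k : Type) [Field k] (U : Set (Fin n)) (comp : Fin n → C) :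
    Ideal (MvPolynomial (Fin n ⊕ Fin n) k) :=
  Ideal.span
    ({f | ∃ i ∈ U, f = X (Sum.inl i) ∨ f = X (Sum.inr i)} ∪
     {f | ∃ i j : Fin n, i ∉ U ∧ j ∉ U ∧ comp i = comp j ∧ i ≠ j ∧
        f = X (Sum.inl i) * X (Sum.inr j) - X (Sum.inl j) * X (Sum.inr i)})

/-- Weights for which `x_i y_j` is the leading monomial of the minor on the columns `i < j`. -/
def varWeight : Fin n ⊕ Fin n → ℤ
  | Sum.inl i => n - i
  | Sum.inr _ => 0

/-- The vertex cover attached to `s`: it contains all `x_i, y_i` with `i ∈ U`, and in the block `c`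
the `x_i` with `i < s c` and the `y_i` with `s c < i`. -/
def Cover (U : Set (Fin n)) (comp : Fin n → C) (s : C → ℕ) : Fin n ⊕ Fin n → Prop
  | Sum.inl i => i ∈ U ∨ (i : ℕ) < s (comp i)
  | Sum.inr i => i ∈ U ∨ s (comp i) < (i : ℕ)

open Classical in
/-- The degree of a monomial in the variables belonging to a cover. -/
noncomputable def coverDegree (U : Set (Fin n)) (comp : Fin n → C) (s : C → ℕ) :
    (Fin n ⊕ Fin n →₀ ℕ) →+ ℕ :=
  Finsupp.weight fun v => if Cover U comp s v then 1 else 0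

/-- The variables of a ring parametrizing a neighbourhood of the locus of matrices all of whose
blocks have rank at most one: the parameters `p c, q c, u i` of the locus, the normal directions
`z v`, and a variable `T` measuring the order of vanishing. -/
inductive ParamVar (n : ℕ) (C : Type) : Type
  | T : ParamVar n C
  | p : C → ParamVar n C
  | q : C → ParamVar n C
  | u : Fin n → ParamVar n C
  | z : Fin n ⊕ Fin n → ParamVar n C

section Param

variable (k : Type) [Field k] (U : Set (Fin n)) (comp : Fin n → C) (s : C → ℕ)

open Classical in
/-- The generic point of the locus where all blocks have rank at most one. -/
noncomputable def basePoint : Fin n ⊕ Fin n → MvPolynomial (ParamVar n C) k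
  | Sum.inl i => if i ∈ U then 0 else X (.p (comp i)) * X (.u i)
  | Sum.inr i => if i ∈ U then 0 else X (.q (comp i)) * X (.u i)

open Classical in
/-- The deformation of the generic point in the direction of the variables of a cover. -/
noncomputable def deform :
    MvPolynomial (Fin n ⊕ Fin n) k →ₐ[k] MvPolynomial (ParamVar n C) k :=
  aeval fun v => basePoint k U comp v + if Cover U comp s v then X .T * X (.z v) else 0

open Classical in
/-- The exponent of the leading monomial of the image of a variable under `deform`. -/
noncomputable def leadExp (v : Fin n ⊕ Fin n) : ParamVar n C →₀ ℕ :=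
  if Cover U comp s v then .single .T 1 + .single (.z v) 1
  else match v with
    | Sum.inl i => .single (.p (comp i)) 1 + .single (.u i) 1
    | Sum.inr i => .single (.q (comp i)) 1 + .single (.u i) 1

/-- Weights on the parameters compatible with `varWeight`. -/
def paramWeight : ParamVar n C → ℤ
  | .T => 0
  | .p c => n - s c
  | .q _ => 0
  | .u i => min 0 (s (comp i) - i)
  | .z v => varWeight v

theorem weight_leadExp (v : Fin n ⊕ Fin n) :
    Finsupp.weight (paramWeight comp s) (leadExp U comp s v) = varWeight v := by
  unfold leadExp
  split_ifs with h
  · simp [Finsupp.weight_single, paramWeight]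
  · rcases v with i | i <;> simp only [Cover, not_or, not_lt] at h <;>
      simp only [map_add, Finsupp.weight_single, paramWeight, varWeight, one_smul] <;> omega

theorem hasLead_deform (v : Fin n ⊕ Fin n) :
    HasLead (paramWeight comp s) (deform k U comp s (X v)) (leadExp U comp s v) := by
  have hXX : ∀ a b : ParamVar n C, (X a * X b : MvPolynomial (ParamVar n C) k) =
      monomial (.single a 1 + .single b 1) 1 := by
    intro a b
    simp [X, monomial_mul]
  by_cases h : Cover U comp s v
  · have hE : leadExp U comp s v = .single .T 1 + .single (.z v) 1 := by simp [leadExp, h]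
    have hD : deform k U comp s (X v) = X .T * X (.z v) + basePoint k U comp v := by
      simp [deform, h, add_comm]
    rw [hD, hE, hXX]
    rcases v with i | i <;> by_cases hi : i ∈ U
    · simpa [basePoint, hi] using HasLead.monomial_one (R := k) _ _
    · simp only [basePoint, hi, if_false, hXX]
      apply HasLead.monomial_add
      simp only [Cover, hi, false_or] at h
      simp only [map_add, Finsupp.weight_single, paramWeight, varWeight, one_smul]
      omega
    · simpa [basePoint, hi] using HasLead.monomial_one (R := k) _ _
    · simp only [basePoint, hi, if_false, hXX]
      apply HasLead.monomial_add
      simp only [Cover, hi, false_or] at h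
      simp only [map_add, Finsupp.weight_single, paramWeight, varWeight, one_smul]
      omega
  · rcases v with i | i
    all_goals
      have hi : i ∉ U := fun hi => h (Or.inl hi)
      simp only [deform, aeval_X, basePoint, leadExp, h, hi, if_false, add_zero, hXX]
      exact HasLead.monomial_one _ _

theorem weight_leadExp_apply (m : Fin n ⊕ Fin n →₀ ℕ) (a : ParamVar n C) :
    Finsupp.weight (leadExp U comp s) m a =
      ∑ i, m (Sum.inl i) * leadExp U comp s (Sum.inl i) a +
        ∑ i, m (Sum.inr i) * leadExp U comp s (Sum.inr i) a := by
  rw [Finsupp.weight_eq_sum, Fintype.sum_sum_type]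
  simp

theorem weight_leadExp_T (m : Fin n ⊕ Fin n →₀ ℕ) :
    Finsupp.weight (leadExp U comp s) m .T = coverDegree U comp s m := by
  rw [weight_leadExp_apply, coverDegree, Finsupp.weight_eq_sum, Fintype.sum_sum_type]
  congr 1 <;> refine Finset.sum_congr rfl fun i _ => ?_ <;> simp only [leadExp] <;>
    split_ifs <;> simp

theorem weight_leadExp_z (m : Fin n ⊕ Fin n →₀ ℕ) {v : Fin n ⊕ Fin n} (hv : Cover U comp s v) :
    Finsupp.weight (leadExp U comp s) m (.z v) = m v := by
  classical
  rw [Finsupp.weight_eq_sum, Finsupp.finsetSum_apply, Finset.sum_eq_single v]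
  · simp [leadExp, hv]
  · intro v' _ hne
    simp only [Finsupp.smul_apply, leadExp]
    split_ifs
    · simp [hne]
    · rcases v' with i | i <;> simp
  · simp

open Classical in
theorem weight_leadExp_u (m : Fin n ⊕ Fin n →₀ ℕ) (i : Fin n) :
    Finsupp.weight (leadExp U comp s) m (.u i) =
      (if Cover U comp s (Sum.inl i) then 0 else m (Sum.inl i)) +
        (if Cover U comp s (Sum.inr i) then 0 else m (Sum.inr i)) := by
  rw [weight_leadExp_apply]
  congr 1 <;> rw [Finset.sum_eq_single i]
  any_goals simp
  any_goals
    simp only [leadExp]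
    split_ifs <;> simp
  all_goals
    intro j hj
    right
    simp only [leadExp]
    split_ifs <;> simp [hj]

open Classical in
theorem weight_leadExp_p (m : Fin n ⊕ Fin n →₀ ℕ) (c : C) :
    Finsupp.weight (leadExp U comp s) m (.p c) =
      ∑ i, if ¬ Cover U comp s (Sum.inl i) ∧ comp i = c then m (Sum.inl i) else 0 := by
  rw [weight_leadExp_apply, Finset.sum_eq_zero (s := Finset.univ)
    (f := fun i => m (Sum.inr i) * leadExp U comp s (Sum.inr i) (.p c)), add_zero]
  · refine Finset.sum_congr rfl fun i _ => ?_
    simp only [leadExp]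
    split_ifs <;> simp_all
  · intro i _
    simp only [leadExp]
    split_ifs <;> simp

theorem injective_weight_leadExp :
    Function.Injective (Finsupp.weight (R := ℕ) (leadExp U comp s)) := by
  classical
  intro m m' h
  have hcov : ∀ v, Cover U comp s v → m v = m' v := fun v hv => by
    rw [← weight_leadExp_z U comp s m hv, h, weight_leadExp_z U comp s m' hv]
  have hu : ∀ i, _ := fun i => (weight_leadExp_u U comp s m i).symm.trans
    ((DFunLike.congr_fun h (.u i)).trans (weight_leadExp_u U comp s m' i))
  have hne : ∀ i : Fin n, (i : ℕ) ≠ s (comp i) → m (Sum.inl i) = m' (Sum.inl i) := by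
    intro i hi
    by_cases hx : Cover U comp s (Sum.inl i)
    · exact hcov _ hx
    · have hy : Cover U comp s (Sum.inr i) := by
        simp only [Cover, not_or] at hx ⊢
        right
        omega
      simpa [hx, hy] using hu i
  have hinl : ∀ i, m (Sum.inl i) = m' (Sum.inl i) := by
    intro i
    by_cases hx : Cover U comp s (Sum.inl i)
    · exact hcov _ hx
    by_cases hi : (i : ℕ) = s (comp i)
    · have hp := (weight_leadExp_p U comp s m (comp i)).symm.trans
        ((DFunLike.congr_fun h (.p (comp i))).trans (weight_leadExp_p U comp s m' (comp i)))
      rw [← Finset.add_sum_erase _ _ (Finset.mem_univ i),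
        ← Finset.add_sum_erase _ _ (Finset.mem_univ i)] at hp
      have hrest : ∀ j ∈ Finset.univ.erase i,
          (if ¬ Cover U comp s (Sum.inl j) ∧ comp j = comp i then m (Sum.inl j) else 0) =
          (if ¬ Cover U comp s (Sum.inl j) ∧ comp j = comp i then m' (Sum.inl j) else 0) := by
        intro j hj
        split_ifs with hc
        · refine hne j fun hjs => Finset.ne_of_mem_erase hj (Fin.ext ?_)
          rw [hjs, hc.2, hi]
        · rfl
      rw [Finset.sum_congr rfl hrest] at hp
      simpa [hx] using hp
    · exact hne i hi
  ext v
  rcases v with i | i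
  · exact hinl i
  · by_cases hy : Cover U comp s (Sum.inr i)
    · exact hcov _ hy
    · simpa [hy, hinl i] using hu i

theorem T_dvd_deform_X_sub (v : Fin n ⊕ Fin n) :
    X .T ∣ deform k U comp s (X v) - basePoint k U comp v := by
  simp only [deform, aeval_X, add_sub_cancel_left]
  split_ifs
  · exact dvd_mul_right _ _
  · exact dvd_zero _

/-- Modulo `T` the deformation does not depend on the cover. -/
theorem T_dvd_deform_congr (s' : C → ℕ) (f : MvPolynomial (Fin n ⊕ Fin n) k)
    (h : X .T ∣ deform k U comp s f) : X .T ∣ deform k U comp s' f := by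
  have heq : (Ideal.Quotient.mkₐ k (Ideal.span {X .T})).comp (deform k U comp s) =
      (Ideal.Quotient.mkₐ k (Ideal.span {X .T})).comp (deform k U comp s') := by
    refine MvPolynomial.algHom_ext fun v => ?_
    simp only [AlgHom.comp_apply, Ideal.Quotient.mkₐ_eq_mk]
    rw [Ideal.Quotient.eq, Ideal.mem_span_singleton]
    simpa using dvd_sub (T_dvd_deform_X_sub k U comp s v) (T_dvd_deform_X_sub k U comp s' v)
  have hf := DFunLike.congr_fun heq f
  simp only [AlgHom.comp_apply, Ideal.Quotient.mkₐ_eq_mk] at hf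
  rw [Ideal.Quotient.eq, Ideal.mem_span_singleton] at hf
  exact (dvd_iff_dvd_of_dvd_sub hf).mp h

theorem T_dvd_deform {f : MvPolynomial (Fin n ⊕ Fin n) k} (hf : f ∈ minorIdeal k U comp) :
    X .T ∣ deform k U comp s f := by
  suffices h : minorIdeal k U comp ≤ (Ideal.span {X .T}).comap (deform k U comp s) from
    Ideal.mem_span_singleton.mp (h hf)
  refine Ideal.span_le.mpr ?_
  have key := T_dvd_deform_X_sub k U comp s
  rintro _ (⟨i, hi, rfl | rfl⟩ | ⟨i, j, hi, hj, hc, -, rfl⟩)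
  · simpa [basePoint, hi, Ideal.mem_span_singleton] using key (Sum.inl i)
  · simpa [basePoint, hi, Ideal.mem_span_singleton] using key (Sum.inr i)
  · obtain ⟨a, ha⟩ := key (Sum.inl i)
    obtain ⟨b, hb⟩ := key (Sum.inr j)
    obtain ⟨c, hc'⟩ := key (Sum.inl j)
    obtain ⟨d, hd⟩ := key (Sum.inr i)
    rw [sub_eq_iff_eq_add] at ha hb hc' hd
    simp only [SetLike.mem_coe, Ideal.mem_comap, Ideal.mem_span_singleton, map_sub, map_mul]
    rw [ha, hb, hc', hd]
    simp only [basePoint, hi, hj, if_false, hc]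
    refine ⟨X .T * a * b + a * (X (.q (comp j)) * X (.u j)) + X (.p (comp j)) * X (.u i) * b
      - X .T * c * d - c * (X (.q (comp j)) * X (.u i)) - X (.p (comp j)) * X (.u j) * d, ?_⟩
    ring

theorem T_pow_dvd_deform {t : ℕ} {f : MvPolynomial (Fin n ⊕ Fin n) k}
    (hf : f ∈ minorIdeal k U comp ^ t) : X .T ^ t ∣ deform k U comp s f := by
  have hle : minorIdeal k U comp ≤ (Ideal.span {X .T}).comap (deform k U comp s) := fun g hg =>
    Ideal.mem_span_singleton.mpr (T_dvd_deform k U comp s hg)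
  have := Ideal.le_comap_pow (deform k U comp s) t (Ideal.pow_right_mono hle t hf)
  rwa [Ideal.mem_comap, Ideal.span_singleton_pow, Ideal.mem_span_singleton] at this

end Param

section Cover

variable (U : Set (Fin n)) (comp : Fin n → C)

theorem coverDegree_eq_zero {s : C → ℕ} {m : Fin n ⊕ Fin n →₀ ℕ}
    (h : ∀ v, Cover U comp s v → m v = 0) : coverDegree U comp s m = 0 := by
  rw [coverDegree, Finsupp.weight_eq_sum]
  refine Finset.sum_eq_zero fun v _ => ?_
  split_ifs with hv
  · simp [h v hv]
  · simp

/-- Comparison of the degrees for two covers, the second of which omits `v₀`. -/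
theorem coverDegree_add_le {s s' : C → ℕ} {m : Fin n ⊕ Fin n →₀ ℕ} {v₀ : Fin n ⊕ Fin n}
    (h : ∀ v, Cover U comp s' v → m v ≠ 0 → Cover U comp s v) (hs : Cover U comp s v₀)
    (hs' : ¬ Cover U comp s' v₀) : coverDegree U comp s' m + m v₀ ≤ coverDegree U comp s m := by
  classical
  simp only [coverDegree, Finsupp.weight_eq_sum]
  rw [← Finset.add_sum_erase _ _ (Finset.mem_univ v₀),
    ← Finset.add_sum_erase _ (fun v => m v • if Cover U comp s v then 1 else 0)
      (Finset.mem_univ v₀)]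
  have : ∑ v ∈ Finset.univ.erase v₀, m v • (if Cover U comp s' v then 1 else 0) ≤
      ∑ v ∈ Finset.univ.erase v₀, m v • (if Cover U comp s v then 1 else 0) := by
    refine Finset.sum_le_sum fun v _ => ?_
    by_cases hv : Cover U comp s' v
    · by_cases hm : m v = 0
      · simp [hm]
      · simp [hv, h v hv hm]
    · simp [hv]
  simp only [hs, hs', if_true, if_false, smul_eq_mul, mul_one, mul_zero] at this ⊢
  omega

/-- If no leading monomial of a generator divides `m`, then `m` avoids some cover. -/
theorem exists_coverDegree_eq_zero {m : Fin n ⊕ Fin n →₀ ℕ}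
    (hU : ∀ i ∈ U, m (Sum.inl i) = 0 ∧ m (Sum.inr i) = 0)
    (hpair : ∀ i j, i ∉ U → j ∉ U → comp i = comp j → i < j → m (Sum.inl i) ≠ 0 →
      m (Sum.inr j) = 0) :
    ∃ s, coverDegree U comp s m = 0 := by
  classical
  have hex : ∀ c, ∃ r : ℕ, (∀ i ∉ U, comp i = c → (i : ℕ) < r → m (Sum.inl i) = 0) ∧
      (∀ j ∉ U, comp j = c → r < (j : ℕ) → m (Sum.inr j) = 0) := by
    intro c
    by_cases h : ∃ r : ℕ, ∃ i : Fin n, (i : ℕ) = r ∧ i ∉ U ∧ comp i = c ∧ m (Sum.inl i) ≠ 0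
    · refine ⟨Nat.find h, fun i hi hic hlt => ?_, fun j hj hjc hlt => ?_⟩
      · by_contra hne
        exact Nat.find_min h hlt ⟨i, rfl, hi, hic, hne⟩
      · obtain ⟨i, hir, hi, hic, hne⟩ := Nat.find_spec h
        exact hpair i j hi hj (hic.trans hjc.symm) (by rw [Fin.lt_def, hir]; exact hlt) hne
    · refine ⟨n, fun i hi hic _ => ?_, fun j _ _ hlt => absurd j.isLt (by omega)⟩
      by_contra hne
      exact h ⟨i, i, rfl, hi, hic, hne⟩
  choose s hs using hex
  refine ⟨s, coverDegree_eq_zero U comp ?_⟩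
  rintro (i | i) hv <;> by_cases hi : i ∈ U
  · exact (hU i hi).1
  · exact (hs (comp i)).1 i hi rfl (hv.resolve_left hi)
  · exact (hU i hi).2
  · exact (hs (comp i)).2 i hi rfl (hv.resolve_left hi)

/-- Removing `x_i y_j` from a monomial, where `j` is the first column to the right of `i` in the
block of `i` with `y_j` dividing the monomial, lowers the minimal cover degree by at most one. -/
theorem le_coverDegree_of_first {m : Fin n ⊕ Fin n →₀ ℕ} {t : ℕ} {i j : Fin n}
    (hi : i ∉ U) (hj : j ∉ U) (hc : comp i = comp j)
    (h : ∀ s, t + 1 ≤ coverDegree U comp s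
      (m + (Finsupp.single (Sum.inl i) 1 + Finsupp.single (Sum.inr j) 1)))
    (hfirst : ∀ l ∉ U, comp i = comp l → i < l → l < j → m (Sum.inr l) = 0) (s : C → ℕ) :
    t ≤ coverDegree U comp s m := by
  classical
  have hs := h s
  have hsingle : ∀ v, coverDegree U comp s (Finsupp.single v 1) =
      if Cover U comp s v then 1 else 0 := fun v => by
    rw [coverDegree, Finsupp.weight_single, one_smul]
  have hsum : coverDegree U comp s
      (m + (Finsupp.single (Sum.inl i) 1 + Finsupp.single (Sum.inr j) 1)) =
      coverDegree U comp s m + ((if Cover U comp s (Sum.inl i) then 1 else 0) +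
        if Cover U comp s (Sum.inr j) then 1 else 0) := by
    rw [map_add, map_add, hsingle, hsingle]
  by_cases hx : Cover U comp s (Sum.inl i)
  swap
  · rw [hsum, if_neg hx] at hs
    split_ifs at hs <;> omega
  by_cases hy : Cover U comp s (Sum.inr j)
  swap
  · rw [hsum, if_neg hy, if_pos hx] at hs
    omega
  have his : (i : ℕ) < s (comp i) := hx.resolve_left hi
  have hsj : s (comp j) < (j : ℕ) := hy.resolve_left hj
  have hle := coverDegree_add_le U comp (s := s) (s' := Function.update s (comp i) i)
    (m := m + (Finsupp.single (Sum.inl i) 1 + Finsupp.single (Sum.inr j) 1))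
    (v₀ := Sum.inl i) ?_ hx (by simp [Cover, hi])
  · have hs' := h (Function.update s (comp i) i)
    rw [hsum, if_pos hx, if_pos hy] at hle
    simp only [Finsupp.add_apply, Finsupp.single_eq_same] at hle
    omega
  · rintro (l | l) hl hml <;> by_cases hlU : l ∈ U
    · exact Or.inl hlU
    · have hlcov := hl.resolve_left hlU
      right
      by_cases hcl : comp l = comp i
      · rw [hcl, Function.update_self] at hlcov
        rw [hcl]
        omega
      · rwa [Function.update_of_ne hcl] at hlcov
    · exact Or.inl hlU
    · have hlcov := hl.resolve_left hlU
      right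
      by_cases hcl : comp l = comp i
      · rw [hcl, Function.update_self] at hlcov
        rw [hcl, hc]
        refine hsj.trans_le ?_
        by_contra hlt
        have hlj : l ≠ j := by rintro rfl; exact hlt le_rfl
        refine hml ?_
        simp [hfirst l hlU hcl.symm hlcov (not_le.mp hlt), hlj.symm]
      · rwa [Function.update_of_ne hcl] at hlcov

/-- Every monomial whose degree with respect to all covers is at least `t` is the leading
monomial of an element of the `t`-th power of the ideal. -/
theorem exists_hasLead (k : Type) [Field k] (t : ℕ) (m : Fin n ⊕ Fin n →₀ ℕ)
    (h : ∀ s, t ≤ coverDegree U comp s m) :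
    ∃ g ∈ minorIdeal k U comp ^ t, HasLead varWeight g m := by
  classical
  induction t generalizing m with
  | zero => exact ⟨monomial m 1, by simp, HasLead.monomial_one _ _⟩
  | succ t ih =>
    by_cases hvar : ∃ i ∈ U, ∃ v, (v = Sum.inl i ∨ v = Sum.inr i) ∧ m v ≠ 0
    · obtain ⟨i, hi, v, hv, hmv⟩ := hvar
      obtain ⟨m, rfl⟩ : ∃ m', m = m' + Finsupp.single v 1 :=
        ⟨m - Finsupp.single v 1, (Finsupp.sub_add_single_one_cancel hmv).symm⟩
      obtain ⟨g, hg, hlead⟩ := ih m fun s => by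
        have hs := h s
        have hcov : Cover U comp s v := by rcases hv with rfl | rfl <;> exact Or.inl hi
        rw [map_add, coverDegree, Finsupp.weight_single, if_pos hcov] at hs
        simpa [coverDegree] using hs
      refine ⟨g * X v, ?_, hlead.mul (HasLead.monomial_one _ _)⟩
      rw [pow_succ]
      refine Ideal.mul_mem_mul hg (Ideal.subset_span (Or.inl ⟨i, hi, ?_⟩))
      rcases hv with rfl | rfl <;> simp
    by_cases hpair : ∃ i j, i ∉ U ∧ j ∉ U ∧ comp i = comp j ∧ i < j ∧ m (Sum.inl i) ≠ 0 ∧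
        m (Sum.inr j) ≠ 0
    · obtain ⟨i, hij⟩ := hpair
      obtain ⟨j, ⟨hi, hj, hc, hlt, hmi, hmj⟩, hmin⟩ := WellFounded.has_min
        (wellFounded_lt (α := Fin n)) {j | i ∉ U ∧ j ∉ U ∧ comp i = comp j ∧ i < j ∧
          m (Sum.inl i) ≠ 0 ∧ m (Sum.inr j) ≠ 0} hij
      have hfirst : ∀ l ∉ U, comp i = comp l → i < l → l < j → m (Sum.inr l) = 0 := by
        intro l hl hcl hil hlj
        by_contra hne
        exact hmin l ⟨hi, hl, hcl, hil, hmi, hne⟩ hlj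
      obtain ⟨m, rfl⟩ : ∃ m', m = m' +
          (Finsupp.single (Sum.inl i) 1 + Finsupp.single (Sum.inr j) 1) := by
        refine ⟨m - (Finsupp.single (Sum.inl i) 1 + Finsupp.single (Sum.inr j) 1),
          (tsub_add_cancel_of_le fun v => ?_).symm⟩
        rcases v with l | l
        · by_cases hl : i = l
          · subst hl
            simpa using Nat.one_le_iff_ne_zero.mpr hmi
          · simp [hl]
        · by_cases hl : j = l
          · subst hl
            simpa using Nat.one_le_iff_ne_zero.mpr hmj
          · simp [hl]
      obtain ⟨g, hg, hlead⟩ := ih m (le_coverDegree_of_first U comp hi hj hc h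
        fun l hl hcl hil hlj => (Nat.add_eq_zero_iff.mp (hfirst l hl hcl hil hlj)).1)
      have hbin : X (Sum.inl i) * X (Sum.inr j) - X (Sum.inl j) * X (Sum.inr i) =
          (monomial (.single (Sum.inl i) 1 + .single (Sum.inr j) 1) 1 +
            monomial (.single (Sum.inl j) 1 + .single (Sum.inr i) 1) (-1) :
            MvPolynomial (Fin n ⊕ Fin n) k) := by
        simp [X, monomial_mul, sub_eq_add_neg]
      refine ⟨g * (X (Sum.inl i) * X (Sum.inr j) - X (Sum.inl j) * X (Sum.inr i)), ?_, ?_⟩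
      · rw [pow_succ]
        exact Ideal.mul_mem_mul hg
          (Ideal.subset_span (Or.inr ⟨i, j, hi, hj, hc, hlt.ne, rfl⟩))
      · rw [hbin]
        refine hlead.mul (HasLead.monomial_add ?_ _)
        simpa [Finsupp.weight_single, varWeight] using hlt
    · obtain ⟨s, hs⟩ := exists_coverDegree_eq_zero U comp (m := m)
        (fun i hi => ⟨by_contra fun hne => hvar ⟨i, hi, _, Or.inl rfl, hne⟩,
          by_contra fun hne => hvar ⟨i, hi, _, Or.inr rfl, hne⟩⟩)
        (fun i j hi hj hc hlt hmi => by_contra fun hmj => hpair ⟨i, j, hi, hj, hc, hlt, hmi, hmj⟩)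
      have := h s
      omega

end Cover

section Powers

variable {k : Type} [Field k] {U : Set (Fin n)} {comp : Fin n → C}

theorem weight_varWeight_nonneg (m : Fin n ⊕ Fin n →₀ ℕ) : 0 ≤ Finsupp.weight varWeight m := by
  rw [Finsupp.weight_eq_sum]
  refine Finset.sum_nonneg fun v _ => nsmul_nonneg ?_ _
  rcases v with i | i <;> simp only [varWeight]
  · omega
  · exact le_rfl

theorem mem_minorIdeal_pow_of_weight_lt {t : ℕ} (d : ℕ) (f : MvPolynomial (Fin n ⊕ Fin n) k)
    (hd : ∀ m, coeff m f ≠ 0 → Finsupp.weight varWeight m < (d : ℤ))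
    (hf : ∀ s, X .T ^ t ∣ deform k U comp s f) : f ∈ minorIdeal k U comp ^ t := by
  classical
  induction d generalizing f with
  | zero =>
    have : f = 0 := by
      ext m
      by_contra hne
      have := hd m hne
      have := weight_varWeight_nonneg m
      omega
    simp [this]
  | succ d ih =>
    have hlead : ∀ m, ∃ g ∈ minorIdeal k U comp ^ t,
        coeff m f ≠ 0 → Finsupp.weight varWeight m = d → HasLead varWeight g m := by
      intro m
      by_cases hm : coeff m f ≠ 0 ∧ Finsupp.weight varWeight m = d
      · obtain ⟨g, hg, hgm⟩ := exists_hasLead U comp k t m fun s => by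
          rw [← weight_leadExp_T]
          refine le_of_X_pow_dvd (hf s) ?_
          rw [HasLead.coeff_map (deform k U comp s) _ (hasLead_deform k U comp s)
            (weight_leadExp U comp s) (injective_weight_leadExp U comp s)]
          · exact hm.1
          · intro m' hm'
            have := hd m' hm'
            push_cast at this
            omega
        exact ⟨g, hg, fun _ _ => hgm⟩
      · exact ⟨0, Ideal.zero_mem _, fun h1 h2 => absurd ⟨h1, h2⟩ hm⟩
    choose g hg hgm using hlead
    set top := f.support.filter fun m => Finsupp.weight varWeight m = (d : ℤ) with htop
    have hsum : ∑ m ∈ top, coeff m f • g m ∈ minorIdeal k U comp ^ t :=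
      Ideal.sum_mem _ fun m _ => Submodule.smul_of_tower_mem _ _ (hg m)
    suffices f - ∑ m ∈ top, coeff m f • g m ∈ minorIdeal k U comp ^ t by
      simpa using Ideal.add_mem _ this hsum
    refine ih _ (fun m hm => ?_) fun s => ?_
    · by_contra hlt
      rw [coeff_sub, coeff_sum] at hm
      have hother : ∀ m' ∈ top, m' ≠ m → coeff m (coeff m' f • g m') = 0 := by
        intro m' hm' hne
        obtain ⟨h1, h2⟩ := Finset.mem_filter.mp hm'
        rw [coeff_smul, smul_eq_mul]
        by_contra hmul
        rcases (hgm m' (mem_support_iff.mp h1) h2).2 m (right_ne_zero_of_mul hmul) with h | h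
        · exact hne h.symm
        · omega
      by_cases hmt : m ∈ top
      · obtain ⟨h1, h2⟩ := Finset.mem_filter.mp hmt
        rw [Finset.sum_eq_single_of_mem m hmt hother, coeff_smul,
          (hgm m (mem_support_iff.mp h1) h2).1] at hm
        simp at hm
      · rw [Finset.sum_eq_zero fun m' hm' => hother m' hm' fun h => hmt (h ▸ hm'), sub_zero] at hm
        refine hmt (Finset.mem_filter.mpr ⟨mem_support_iff.mpr hm, ?_⟩)
        have := hd m hm
        push_cast at this
        omega
    · rw [map_sub]
      exact dvd_sub (hf s) (T_pow_dvd_deform k U comp s hsum)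

/-- The powers of the ideal are described by the order of vanishing of the deformations. -/
theorem mem_minorIdeal_pow_iff {t : ℕ} {f : MvPolynomial (Fin n ⊕ Fin n) k} :
    f ∈ minorIdeal k U comp ^ t ↔ ∀ s, X .T ^ t ∣ deform k U comp s f := by
  refine ⟨fun hf s => T_pow_dvd_deform k U comp s hf, fun hf => ?_⟩
  refine mem_minorIdeal_pow_of_weight_lt
    (∑ m ∈ f.support, (Finsupp.weight varWeight m).toNat + 1) f (fun m hm => ?_) hf
  have := Finset.single_le_sum (f := fun m => (Finsupp.weight varWeight m).toNat)
    (fun _ _ => Nat.zero_le _) (mem_support_iff.mpr hm)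
  omega

theorem mem_minorIdeal_iff (s : C → ℕ) {f : MvPolynomial (Fin n ⊕ Fin n) k} :
    f ∈ minorIdeal k U comp ↔ X .T ∣ deform k U comp s f := by
  refine ⟨T_dvd_deform k U comp s, fun h => ?_⟩
  rw [← pow_one (minorIdeal k U comp), mem_minorIdeal_pow_iff]
  intro s'
  rw [pow_one]
  exact T_dvd_deform_congr k U comp s s' f h

instance isPrime_minorIdeal : (minorIdeal k U comp).IsPrime := by
  have hT : (Ideal.span {(X .T : MvPolynomial (ParamVar n C) k)}).IsPrime :=
    (Ideal.span_singleton_prime (X_ne_zero _)).mpr X_prime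
  have : minorIdeal k U comp =
      (Ideal.span {X .T}).comap (deform k U comp fun _ => 0) := by
    ext f
    rw [mem_minorIdeal_iff fun _ => 0, Ideal.mem_comap, Ideal.mem_span_singleton]
  rw [this]
  exact Ideal.comap_isPrime _ _

/-- The powers of the ideal are primary. -/
theorem mem_minorIdeal_pow_of_mul_mem {t : ℕ} {g f : MvPolynomial (Fin n ⊕ Fin n) k}
    (hg : g ∉ minorIdeal k U comp) (h : g * f ∈ minorIdeal k U comp ^ t) :
    f ∈ minorIdeal k U comp ^ t := by
  rw [mem_minorIdeal_pow_iff] at h ⊢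
  intro s
  have hs := h s
  rw [map_mul] at hs
  exact X_prime.pow_dvd_of_dvd_mul_left t (fun hd => hg ((mem_minorIdeal_iff s).mpr hd)) hs

end Powers

end MinorIdeal

/-- If `P` is a prime ideal and `P ^ t` is `P`-primary, then the `t`-th symbolic power of `P` is
the ordinary power. -/
theorem symbolicPower_eq_pow_of_isPrime {S : Type*} [CommRing S] (P : Ideal S) [P.IsPrime] (t : ℕ)
    (h : ∀ g f, g ∉ P → g * f ∈ P ^ t → f ∈ P ^ t) : symbolicPower P t = P ^ t := by
  have hmem : P ∈ P.minimalPrimes := by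
    rw [Ideal.minimalPrimes_eq_subsingleton_self]
    exact Set.mem_singleton P
  apply le_antisymm
  · intro f hf
    have hf' := (Submodule.mem_iInf _).mp ((Submodule.mem_iInf _).mp hf P) hmem
    obtain ⟨g, hg, hgf⟩ := (IsLocalization.algebraMap_mem_map_algebraMap_iff
      P.primeCompl (Localization.AtPrime P) (P ^ t) f).mp hf'
    exact h g f hg hgf
  · exact le_iInf fun _ => le_iInf fun _ => Ideal.le_comap_map

open Classical in
/-- The vertices outside `U` are grouped by their connected component. -/
noncomputable def componentOf {n : ℕ} (G : SimpleGraph (Fin n)) (U : Set (Fin n)) (i : Fin n) :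
    Option (G.induce Uᶜ).ConnectedComponent :=
  if hi : i ∈ Uᶜ then some ((G.induce Uᶜ).connectedComponentMk ⟨i, hi⟩) else none

theorem PUIdeal_eq_minorIdeal (k : Type) [Field k] {n : ℕ} (G : SimpleGraph (Fin n))
    (U : Set (Fin n)) : PUIdeal k G U = MinorIdeal.minorIdeal k U (componentOf G U) := by
  unfold PUIdeal MinorIdeal.minorIdeal
  congr 2
  ext f
  have key : ∀ (i j : Fin n) (hi : i ∈ Uᶜ) (hj : j ∈ Uᶜ),
      componentOf G U i = componentOf G U j ↔ (G.induce Uᶜ).Reachable ⟨i, hi⟩ ⟨j, hj⟩ := by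
    intro i j hi hj
    rw [componentOf, componentOf, dif_pos hi, dif_pos hj, Option.some_inj,
      SimpleGraph.ConnectedComponent.eq]
  constructor
  · rintro ⟨i, j, hi, hj, hr, hne, rfl⟩
    exact ⟨i, j, hi, hj, (key i j hi hj).mpr hr, hne, rfl⟩
  · rintro ⟨i, j, hi, hj, hr, hne, rfl⟩
    exact ⟨i, j, hi, hj, (key i j hi hj).mp hr, hne, rfl⟩

/-- For any subset `U ⊆ [n]` and any graph `G` on `[n]`, the symbolic and ordinary powers of
the prime ideal `P_U(G)` coincide: `P_U(G) ^ (t) = P_U(G) ^ t` for every `t ≥ 1`. -/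
theorem symbolic_eq_ordinary_PUIdeal {n : ℕ} (k : Type) [Field k]
    (G : SimpleGraph (Fin n)) (U : Set (Fin n)) :
    ∀ t : ℕ, 1 ≤ t → symbolicPower (PUIdeal k G U) t = PUIdeal k G U ^ t := by
  intro t _
  rw [PUIdeal_eq_minorIdeal]
  exact symbolicPower_eq_pow_of_isPrime _ t fun _ _ => MinorIdeal.mem_minorIdeal_pow_of_mul_mem
end

section
/- Let G_1 and G_2 be graphs on disjoint vertex sets, and let I = J_{G_1} and J = J_{G_2} be their binomial edge ideals, regarded in the polynomial ring S over a field k whose variables are x_v, y_v for all vertices v of G_1 and G_2 (so the generators of I and J involve disjoint sets of variables). Fix an integer n ≥ 1 and assume that I^t ≠ I^{t+1} and J^t ≠ J^{t+1} for every t ≤ n − 1. Then (I + J)^(n) = (I + J)^n if and only if I^(t) = I^t and J^(t) = J^t for every t ≤ n. -/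
open MvPolynomial

/-- The binomial edge ideal of a simple graph `G`, in the polynomial ring
`k[x_i, y_i : i ∈ V]` (variables indexed by `V ⊕ V`: `Sum.inl i ↦ x_i`, `Sum.inr i ↦ y_i`),
generated by the binomials `x_i y_j - x_j y_i` for edges `{i, j}` of `G`. -/
noncomputable def binomialEdgeIdeal (k : Type) [Field k] {V : Type} (G : SimpleGraph V) :
    Ideal (MvPolynomial (V ⊕ V) k) :=
  Ideal.span {f | ∃ i j, G.Adj i j ∧
    f = X (Sum.inl i) * X (Sum.inr j) - X (Sum.inl j) * X (Sum.inr i)}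

/-- The copy of `G₁` on the disjoint union `V₁ ⊕ V₂`, placed on the left summand. -/
def sumLeft {V₁ : Type} (V₂ : Type) (G₁ : SimpleGraph V₁) : SimpleGraph (V₁ ⊕ V₂) :=
  SimpleGraph.fromRel fun x y => ∃ a b, G₁.Adj a b ∧ x = Sum.inl a ∧ y = Sum.inl b

/-- The copy of `G₂` on the disjoint union `V₁ ⊕ V₂`, placed on the right summand. -/
def sumRight (V₁ : Type) {V₂ : Type} (G₂ : SimpleGraph V₂) : SimpleGraph (V₁ ⊕ V₂) :=
  SimpleGraph.fromRel fun x y => ∃ a b, G₂.Adj a b ∧ x = Sum.inr a ∧ y = Sum.inr b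

open TensorProduct

theorem mem_symbolicPower_iff {S : Type*} [CommRing S] {I : Ideal S} {t : ℕ} {f : S} :
    f ∈ symbolicPower I t ↔ ∀ p ∈ I.minimalPrimes, ∃ s ∉ p, s * f ∈ I ^ t := by
  simp only [symbolicPower, Submodule.mem_iInf, Ideal.mem_comap]
  refine forall₂_congr fun p hp => ?_
  have : p.IsPrime := hp.1.1
  rw [IsLocalization.algebraMap_mem_map_algebraMap_iff p.primeCompl]
  rfl

theorem pow_le_symbolicPower {S : Type*} [CommRing S] (I : Ideal S) (t : ℕ) :
    I ^ t ≤ symbolicPower I t := fun f hf =>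
  mem_symbolicPower_iff.mpr fun _ hp => ⟨1, hp.1.1.one_notMem, by rwa [one_mul]⟩

theorem symbolicPower_zero {S : Type*} [CommRing S] (I : Ideal S) :
    symbolicPower I 0 = I ^ 0 :=
  le_antisymm (by simp) (pow_le_symbolicPower I 0)

theorem comap_pow_ringEquiv {S T : Type*} [CommRing S] [CommRing T] (e : S ≃+* T)
    (J : Ideal T) (t : ℕ) : (J.comap e) ^ t = (J ^ t).comap e := by
  rw [← Ideal.map_symm, ← Ideal.map_symm, Ideal.map_pow]

theorem symbolicPower_comap_ringEquiv {S T : Type*} [CommRing S] [CommRing T] (e : S ≃+* T)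
    (J : Ideal T) (t : ℕ) : symbolicPower (J.comap e) t = (symbolicPower J t).comap e := by
  ext f
  rw [Ideal.mem_comap, mem_symbolicPower_iff, mem_symbolicPower_iff, comap_pow_ringEquiv]
  have h : (J.comap e).minimalPrimes = J.minimalPrimes.image (Ideal.comap e) :=
    Ideal.comap_minimalPrimes_eq_of_surjective (f := (e : S →+* T)) e.surjective J
  rw [h, Set.forall_mem_image]
  refine forall₂_congr fun p _ => Iff.trans ?_ e.surjective.exists.symm
  simp

theorem symbolicPower_eq_pow_comap_ringEquiv_iff {S T : Type*} [CommRing S] [CommRing T]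
    (e : S ≃+* T) (J : Ideal T) (t : ℕ) :
    symbolicPower (J.comap e) t = J.comap e ^ t ↔ symbolicPower J t = J ^ t := by
  rw [symbolicPower_comap_ringEquiv, comap_pow_ringEquiv]
  exact (Ideal.comap_injective_of_surjective e e.surjective).eq_iff

/-- The local ring `A_p / I ^ t A_p` detects membership in the `p`-component of `I ^ t`, and a
homomorphism to a field with kernel `p` factors through it. -/
theorem exists_local_test {k A Ω : Type*} [Field k] [CommRing A] [Algebra k A] [Field Ω]
    [Algebra k Ω] {I p : Ideal A} (hp : p.IsPrime) (hIp : I ≤ p) {t : ℕ} (ht : t ≠ 0)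
    (φ : A →ₐ[k] Ω) (hφ : ∀ a, φ a = 0 ↔ a ∈ p) :
    let C := Localization.AtPrime p ⧸ (I ^ t).map (algebraMap A (Localization.AtPrime p))
    ∃ (_ : IsLocalRing C) (ψ : C →ₐ[k] Ω) (_ : IsLocalHom ψ.toRingHom),
      ψ.comp (IsScalarTower.toAlgHom k A C) = φ ∧
      ∀ f : A, algebraMap A C f = 0 ↔ ∃ s ∉ p, s * f ∈ I ^ t := by
  intro C
  let L := Localization.AtPrime p
  have hu : ∀ y : p.primeCompl, IsUnit (φ y) := fun y =>
    isUnit_iff_ne_zero.mpr fun h => y.2 ((hφ _).mp h)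
  let g : L →ₐ[k] Ω := IsLocalization.liftAlgHom (M := p.primeCompl) (f := φ) hu
  have hg : ∀ a, g (algebraMap A L a) = φ a := fun a => by simp [g]
  have hker : ∀ x ∈ (I ^ t).map (algebraMap A L), g x = 0 := by
    intro x hx
    have : (I ^ t).map (algebraMap A L) ≤ RingHom.ker g := by
      rw [Ideal.map_le_iff_le_comap]
      intro a ha
      rw [Ideal.mem_comap, RingHom.mem_ker, hg, hφ]
      exact hIp (Ideal.pow_le_self ht ha)
    exact this hx
  have : Nontrivial C := Ideal.Quotient.nontrivial_iff.mpr fun h =>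
    one_ne_zero ((map_one g).symm.trans (hker 1 (h ▸ Submodule.mem_top)))
  have hloc : IsLocalRing C := IsLocalRing.of_surjective' (Ideal.Quotient.mk _)
    Ideal.Quotient.mk_surjective
  let ψ : C →ₐ[k] Ω := Ideal.Quotient.liftₐ _ g hker
  refine ⟨hloc, ψ, ⟨?_⟩, ?_, ?_⟩
  · intro c hc
    obtain ⟨x, rfl⟩ := Ideal.Quotient.mk_surjective c
    obtain ⟨a, s, rfl⟩ := IsLocalization.exists_mk'_eq p.primeCompl x
    refine IsUnit.map _ ?_
    rw [IsLocalization.AtPrime.isUnit_mk'_iff L p]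
    intro ha
    have h0 : g (IsLocalization.mk' L a s) = 0 := by
      have : IsLocalization.mk' L a s * algebraMap A L s = algebraMap A L a := by simp
      have h := congrArg g this
      rw [map_mul, hg, hg, (hφ a).mpr ha] at h
      exact (mul_eq_zero.mp h).resolve_right (hu s).ne_zero
    exact hc.ne_zero h0
  · ext a
    exact hg a
  · intro f
    change Ideal.Quotient.mk _ (algebraMap A L f) = 0 ↔ _
    rw [Ideal.Quotient.eq_zero_iff_mem,
      IsLocalization.algebraMap_mem_map_algebraMap_iff p.primeCompl]
    rfl

theorem tensor_eq_zero_of_rTensor {k V W ι : Type*} [Field k] [AddCommGroup V] [Module k V]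
    [AddCommGroup W] [Module k W] {X : ι → Type*} [∀ i, AddCommGroup (X i)] [∀ i, Module k (X i)]
    (v : ∀ i, V →ₗ[k] X i) (hv : ∀ x, (∀ i, v i x = 0) → x = 0) (f : V ⊗[k] W)
    (hf : ∀ i, (v i).rTensor W f = 0) : f = 0 := by
  classical
  let b := Module.Basis.ofVectorSpace k W
  have nat : ∀ i (f : V ⊗[k] W) j, TensorProduct.equivFinsuppOfBasisRight b ((v i).rTensor W f) j =
      v i (TensorProduct.equivFinsuppOfBasisRight b f j) := by
    intro i f j
    induction f with
    | zero => simp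
    | add x y hx hy => simp [hx, hy]
    | tmul x y => simp
  apply (TensorProduct.equivFinsuppOfBasisRight b).injective
  ext j
  rw [map_zero]
  exact hv _ fun i => by rw [← nat, hf, map_zero]; rfl

theorem tensor_tmul_ne_zero {k V W : Type*} [Field k] [AddCommGroup V] [Module k V]
    [AddCommGroup W] [Module k W] {x : V} {y : W} (hx : x ≠ 0) (hy : y ≠ 0) : x ⊗ₜ[k] y ≠ 0 := by
  classical
  let b := Module.Basis.ofVectorSpace k W
  intro h
  have h1 : ∀ j, b.repr y j • x = 0 := fun j => by
    rw [← TensorProduct.equivFinsuppOfBasisRight_apply_tmul_apply, h]; simp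
  refine hy (b.repr.injective ?_)
  ext j
  simpa [hx] using h1 j

theorem map_includeLeft_inf_map_includeRight {k A B : Type*} [Field k] [CommRing A] [Algebra k A]
    [CommRing B] [Algebra k B] (I : Ideal A) (J : Ideal B) :
    I.map (Algebra.TensorProduct.includeLeft : A →ₐ[k] A ⊗[k] B) ⊓
      J.map (Algebra.TensorProduct.includeRight : B →ₐ[k] A ⊗[k] B) ≤
    I.map (Algebra.TensorProduct.includeLeft : A →ₐ[k] A ⊗[k] B) *
      J.map (Algebra.TensorProduct.includeRight : B →ₐ[k] A ⊗[k] B) := by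
  rintro f ⟨hI, hJ⟩
  obtain ⟨π, hπ⟩ := (I.restrictScalars k).subtype.exists_leftInverse_of_injective (by simp)
  obtain ⟨ρ, hρ⟩ := (J.restrictScalars k).subtype.exists_leftInverse_of_injective (by simp)
  have hπ' : ∀ a ∈ I, (π a : A) = a := fun a ha =>
    congrArg Subtype.val (LinearMap.congr_fun hπ ⟨a, ha⟩)
  have hρ' : ∀ a ∈ J, (ρ a : B) = a := fun a ha =>
    congrArg Subtype.val (LinearMap.congr_fun hρ ⟨a, ha⟩)
  let π' : A →ₗ[k] A := (I.restrictScalars k).subtype ∘ₗ π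
  let ρ' : B →ₗ[k] B := (J.restrictScalars k).subtype ∘ₗ ρ
  have h1 : π'.rTensor B f = f := by
    have hf :
        f ∈ (I.map (Algebra.TensorProduct.includeLeft : A →ₐ[k] A ⊗[k] B)).restrictScalars k :=
      hI
    rw [Ideal.map_includeLeft_eq] at hf
    obtain ⟨g, rfl⟩ := hf
    rw [← LinearMap.comp_apply, ← LinearMap.rTensor_comp]
    congr 2
    ext a
    exact hπ' a a.2
  have h2 : ρ'.lTensor A f = f := by
    have hf :
        f ∈ (J.map (Algebra.TensorProduct.includeRight : B →ₐ[k] A ⊗[k] B)).restrictScalars k :=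
      hJ
    rw [Ideal.map_includeRight_eq] at hf
    obtain ⟨g, rfl⟩ := hf
    rw [← LinearMap.comp_apply, ← LinearMap.lTensor_comp]
    congr 2
    ext a
    exact hρ' a a.2
  rw [← h1, ← h2]
  generalize f = g
  induction g with
  | zero => simp
  | add x y hx hy => rw [map_add, map_add]; exact add_mem hx hy
  | tmul a b =>
    have : π'.rTensor B (ρ'.lTensor A (a ⊗ₜ b)) = (π' a ⊗ₜ 1) * (1 ⊗ₜ ρ' b) := by simp
    rw [this]
    exact Ideal.mul_mem_mul (Ideal.mem_map_of_mem _ (π a).2) (Ideal.mem_map_of_mem _ (ρ b).2)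

theorem le_of_le_sup_chains {L : Type*} [Lattice L] [OrderTop L] [IsModularLattice L]
    (U V : ℕ → L) (hV : Antitone V) (hU0 : U 0 = ⊤) (hV0 : V 0 = ⊤)
    (hU : Antitone U) {n : ℕ} (hn : 1 ≤ n) {a x : L} (ha : ∀ i ≤ n, U i ⊓ V (n - i) ≤ a)
    (hx : ∀ i, 1 ≤ i → i ≤ n → x ≤ U i ⊔ V (n + 1 - i)) : x ≤ a := by
  have key : ∀ m, 1 ≤ m → m ≤ n → x ≤ (a ⊓ V (n + 1 - m)) ⊔ U m := by
    intro m hm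
    induction m, hm using Nat.le_induction with
    | base =>
      intro _
      have h0 : V n ≤ a := by simpa [hU0] using ha 0 (Nat.zero_le _)
      simpa [sup_comm, inf_eq_right.mpr h0] using hx 1 le_rfl hn
    | succ m hm ih =>
      intro hmn
      have h1 := le_inf (ih (by omega)) (hx (m + 1) (by omega) hmn)
      rw [Nat.add_sub_add_right] at h1 ⊢
      have hc : a ⊓ V (n + 1 - m) ≤ U (m + 1) ⊔ V (n - m) :=
        inf_le_right.trans ((hV (by omega)).trans le_sup_right)
      rw [sup_inf_assoc_of_le _ hc, inf_comm (U m),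
        sup_inf_assoc_of_le _ (hU (Nat.le_succ m))] at h1
      refine h1.trans (sup_le ?_ (sup_le le_sup_right ?_))
      · exact le_sup_of_le_left (inf_le_inf_left _ (hV (by omega)))
      · refine le_sup_of_le_left (le_inf ?_ inf_le_left)
        rw [inf_comm]
        exact ha m (by omega)
  refine (key n hn le_rfl).trans (sup_le inf_le_left ?_)
  simpa [hV0] using ha n le_rfl

/-- An element of `C ⊗[k] E` with `C` local is regular if its image over a field extension of the
residue field of `C` is regular. -/
theorem mem_nonZeroDivisors_of_map_residue {k C E Ω : Type*} [Field k] [CommRing C] [IsLocalRing C]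
    [Algebra k C] [CommRing E] [Algebra k E] [Field Ω] [Algebra k Ω] (ψ : C →ₐ[k] Ω)
    [IsLocalHom ψ.toRingHom] (s : C ⊗[k] E)
    (hs : Algebra.TensorProduct.map ψ (AlgHom.id k E) s ∈ nonZeroDivisors (Ω ⊗[k] E)) :
    s ∈ nonZeroDivisors (C ⊗[k] E) := by
  let κ := IsLocalRing.ResidueField C
  let ρ : C →ₐ[k] κ := IsScalarTower.toAlgHom k C κ
  let ψ' : κ →ₐ[k] Ω :=
    { IsLocalRing.ResidueField.lift ψ.toRingHom with
      commutes' := fun r => by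
        change IsLocalRing.ResidueField.lift ψ.toRingHom
          (IsLocalRing.residue C (algebraMap k C r)) = _
        simp }
  have hcomp : ψ'.comp ρ = ψ := by
    ext x
    rfl
  let s' : κ ⊗[k] E := Algebra.TensorProduct.map ρ (AlgHom.id k E) s
  have hinj : Function.Injective (Algebra.TensorProduct.map ψ' (AlgHom.id k E)) :=
    Module.Flat.rTensor_preserves_injective_linearMap (M := E) ψ'.toLinearMap ψ'.toRingHom.injective
  have hs' : ∀ x : κ ⊗[k] E, s' * x = 0 → x = 0 := by
    intro x hx
    apply hinj
    rw [map_zero]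
    have h2 : Algebra.TensorProduct.map ψ' (AlgHom.id k E) s' =
        Algebra.TensorProduct.map ψ (AlgHom.id k E) s := by
      rw [← hcomp]
      change ((Algebra.TensorProduct.map ψ' (AlgHom.id k E)).comp
        (Algebra.TensorProduct.map ρ (AlgHom.id k E))) s = _
      rw [← Algebra.TensorProduct.map_comp, AlgHom.id_comp]
    have h3 := congrArg (Algebra.TensorProduct.map ψ' (AlgHom.id k E)) hx
    rw [map_mul, map_zero, h2] at h3
    exact (mem_nonZeroDivisors_iff.mp hs).1 _ h3
  let b := Module.Basis.ofVectorSpace k E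
  let bC := b.baseChange C
  have key : LinearIndependent C (fun i => s * bC i) := by
    apply Module.IsLocalRing.linearIndependent_of_flat
    let Φ := TensorProduct.AlgebraTensorModule.cancelBaseChange k C κ κ E
    have hΦ : ∀ y : C ⊗[k] E, Φ (1 ⊗ₜ y) = Algebra.TensorProduct.map ρ (AlgHom.id k E) y := by
      intro y
      induction y with
      | zero => simp
      | add x y hx hy => rw [tmul_add, map_add, hx, hy, map_add]
      | tmul c e =>
        simp only [Φ, TensorProduct.AlgebraTensorModule.cancelBaseChange_tmul,
          Algebra.TensorProduct.map_tmul, AlgHom.id_apply, Algebra.smul_def, mul_one]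
        rfl
    refine LinearIndependent.of_comp Φ.toLinearMap ?_
    have h1 := (b.baseChange κ).linearIndependent.map' (LinearMap.mulLeft κ s')
      (by
        rw [LinearMap.ker_eq_bot']
        exact hs')
    have h2 : Φ.toLinearMap ∘ TensorProduct.mk C κ (C ⊗[k] E) 1 ∘ (fun i => s * bC i) =
        LinearMap.mulLeft κ s' ∘ b.baseChange κ := by
      funext i
      change Φ (1 ⊗ₜ (s * bC i)) = s' * (b.baseChange κ i)
      rw [hΦ, map_mul]
      simp [bC, s']
    exact h2 ▸ h1
  rw [mem_nonZeroDivisors_iff]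
  have main : ∀ x, s * x = 0 → x = 0 := by
    intro x hx
    have h2 := linearIndependent_iff.mp key (bC.repr x) (by
      rw [← hx]
      conv_rhs => rw [← bC.linearCombination_repr x]
      rw [Finsupp.linearCombination_apply, Finsupp.linearCombination_apply, Finsupp.sum,
        Finsupp.sum, Finset.mul_sum]
      refine Finset.sum_congr rfl fun i _ => ?_
      rw [mul_smul_comm])
    simpa using h2
  exact ⟨main, fun x hx => main x (by rwa [mul_comm])⟩

theorem isDomain_fractionRing_mvPolynomial_tensor (k σ E : Type*) [Field k] [CommRing E]
    [IsDomain E] [Algebra k E] : IsDomain (FractionRing (MvPolynomial σ k) ⊗[k] E) := by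
  let A := MvPolynomial σ k
  let Ω := FractionRing A
  let f : A ⊗[k] E →ₐ[A] Ω ⊗[k] E :=
    Algebra.TensorProduct.map (Algebra.ofId A Ω) (AlgHom.id k E)
  let : Algebra (A ⊗[k] E) (Ω ⊗[k] E) := f.toRingHom.toAlgebra
  have : IsScalarTower A (A ⊗[k] E) (Ω ⊗[k] E) := ⟨fun a x y => by
    change f (a • x) * y = a • (f x * y)
    rw [map_smul, smul_mul_assoc]⟩
  have hloc := IsLocalization.tensorProduct_tensorProduct k E (nonZeroDivisors A) Ω (by
    ext x; simp [RingHom.algebraMap_toAlgebra, f])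
  have : IsDomain (A ⊗[k] E) :=
    ((Algebra.TensorProduct.comm k A E).toRingEquiv.trans
      (MvPolynomial.algebraTensorAlgEquiv (σ := σ) k E).toRingEquiv).toMulEquiv.isDomain _
  refine IsLocalization.isDomain_of_le_nonZeroDivisors (R := A ⊗[k] E) _
    (M := Algebra.algebraMapSubmonoid (A ⊗[k] E) (nonZeroDivisors A)) ?_
  rintro _ ⟨x, hx, rfl⟩
  rw [mem_nonZeroDivisors_iff_ne_zero]
  have hinj : Function.Injective (algebraMap A (A ⊗[k] E)) :=
    Algebra.TensorProduct.includeLeft_injective (S := k) (algebraMap k E).injective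
  exact (map_ne_zero_iff _ hinj).mpr (nonZeroDivisors.ne_zero hx)


theorem sup_pow_le_pow_sup_pow {S : Type*} [CommRing S] (I J : Ideal S) {n i j : ℕ}
    (h : i + j ≤ n + 1) : (I ⊔ J) ^ n ≤ I ^ i ⊔ J ^ j := by
  rw [← Ideal.add_eq_sup, add_pow, Ideal.sum_eq_sup]
  refine Finset.sup_le fun m hm => Ideal.mul_le_left.trans ?_
  have hm' := Finset.mem_range.mp hm
  rcases le_or_gt i m with him | him
  · exact Ideal.mul_le_left.trans ((Ideal.pow_le_pow_right him).trans le_sup_left)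
  · exact Ideal.mul_le_right.trans
      ((Ideal.pow_le_pow_right (show j ≤ n - m by omega)).trans le_sup_right)

theorem pow_mul_pow_le_sup_pow {S : Type*} [CommRing S] (I J : Ideal S) {n i j : ℕ}
    (h : i + j = n) : I ^ i * J ^ j ≤ (I ⊔ J) ^ n := by
  rw [← h, pow_add]
  exact Ideal.mul_mono (Ideal.pow_right_mono le_sup_left _) (Ideal.pow_right_mono le_sup_right _)

section TensorProduct

variable {k A B : Type*} [Field k] [CommRing A] [Algebra k A] [CommRing B] [Algebra k B]

variable (k B) in
/-- The extension to `A ⊗[k] B` of an ideal of the left factor. -/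
abbrev leftExt (I : Ideal A) : Ideal (A ⊗[k] B) :=
  I.map (Algebra.TensorProduct.includeLeft : A →ₐ[k] A ⊗[k] B)

variable (k A) in
/-- The extension to `A ⊗[k] B` of an ideal of the right factor. -/
abbrev rightExt (J : Ideal B) : Ideal (A ⊗[k] B) :=
  J.map (Algebra.TensorProduct.includeRight : B →ₐ[k] A ⊗[k] B)

theorem ker_map_mk (K : Ideal A) (L : Ideal B) :
    RingHom.ker (Algebra.TensorProduct.map (Ideal.Quotient.mkₐ k K) (Ideal.Quotient.mkₐ k L)) =
      leftExt k B K ⊔ rightExt k A L := by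
  rw [Algebra.TensorProduct.map_ker _ _ (Ideal.Quotient.mkₐ_surjective k K)
    (Ideal.Quotient.mkₐ_surjective k L)]
  congr 2
  · exact Ideal.Quotient.mkₐ_ker k K
  · exact Ideal.Quotient.mkₐ_ker k L

theorem tmul_mem_sup {K : Ideal A} {L : Ideal B} {a : A} {b : B}
    (h : a ⊗ₜ[k] b ∈ leftExt k B K ⊔ rightExt k A L) : a ∈ K ∨ b ∈ L := by
  by_contra! hab
  rw [← ker_map_mk, RingHom.mem_ker, Algebra.TensorProduct.map_tmul] at h
  exact tensor_tmul_ne_zero (mt Ideal.Quotient.eq_zero_iff_mem.mp hab.1)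
    (mt Ideal.Quotient.eq_zero_iff_mem.mp hab.2) h

theorem mem_sup_of_forall_map_eq_zero {ι κ : Type*} {X : ι → Type*} {Y : κ → Type*}
    [∀ i, AddCommGroup (X i)] [∀ i, Module k (X i)] [∀ j, AddCommGroup (Y j)]
    [∀ j, Module k (Y j)] (v : ∀ i, A →ₗ[k] X i) (w : ∀ j, B →ₗ[k] Y j)
    {K : Ideal A} {L : Ideal B} (hv : ∀ a, a ∈ K ↔ ∀ i, v i a = 0)
    (hw : ∀ b, b ∈ L ↔ ∀ j, w j b = 0) {f : A ⊗[k] B}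
    (hf : ∀ i j, TensorProduct.map (v i) (w j) f = 0) :
    f ∈ leftExt k B K ⊔ rightExt k A L := by
  rw [← ker_map_mk, RingHom.mem_ker]
  let v' : ∀ i, (A ⧸ K) →ₗ[k] X i := fun i =>
    (K.restrictScalars k).liftQ (v i) fun a ha => (hv a).mp ha i
  let w' : ∀ j, (B ⧸ L) →ₗ[k] Y j := fun j =>
    (L.restrictScalars k).liftQ (w j) fun b hb => (hw b).mp hb j
  have hv' : ∀ x, (∀ i, v' i x = 0) → x = 0 := fun x hx => by
    obtain ⟨a, rfl⟩ := Ideal.Quotient.mk_surjective x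
    exact Ideal.Quotient.eq_zero_iff_mem.mpr ((hv a).mpr hx)
  have hw' : ∀ x, (∀ j, w' j x = 0) → x = 0 := fun x hx => by
    obtain ⟨a, rfl⟩ := Ideal.Quotient.mk_surjective x
    exact Ideal.Quotient.eq_zero_iff_mem.mpr ((hw a).mpr hx)
  refine tensor_eq_zero_of_rTensor v' hv' _ fun i => ?_
  apply (TensorProduct.comm k (X i) (B ⧸ L)).injective
  rw [map_zero]
  refine tensor_eq_zero_of_rTensor w' hw' _ fun j => ?_
  apply (TensorProduct.comm k (Y j) (X i)).injective
  rw [map_zero, ← hf i j]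
  clear hf
  induction f with
  | zero => simp
  | add x y hx hy => simp only [map_add, hx, hy]
  | tmul a b => rfl

theorem mem_sup_iff_map_eq_zero {X Y : Type*} [CommRing X] [Algebra k X] [CommRing Y]
    [Algebra k Y] (φ : A →ₐ[k] X) (χ : B →ₐ[k] Y) {p : Ideal A} {q : Ideal B}
    (hφ : ∀ a, φ a = 0 ↔ a ∈ p) (hχ : ∀ b, χ b = 0 ↔ b ∈ q) (f : A ⊗[k] B) :
    Algebra.TensorProduct.map φ χ f = 0 ↔ f ∈ leftExt k B p ⊔ rightExt k A q := by
  constructor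
  · intro h
    exact mem_sup_of_forall_map_eq_zero (ι := Unit) (κ := Unit) (fun _ => φ.toLinearMap)
      (fun _ => χ.toLinearMap) (by simp [hφ]) (by simp [hχ]) fun _ _ => h
  · have : leftExt k B p ⊔ rightExt k A q ≤ RingHom.ker (Algebra.TensorProduct.map φ χ) := by
      refine sup_le (Ideal.map_le_iff_le_comap.mpr fun a ha => ?_)
        (Ideal.map_le_iff_le_comap.mpr fun b hb => ?_)
      · simp [RingHom.mem_ker, (hφ a).mpr ha]
      · simp [RingHom.mem_ker, (hχ b).mpr hb]
    exact fun h => this h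

theorem isPrime_sup {X Y : Type*} [CommRing X] [Algebra k X] [CommRing Y]
    [Algebra k Y] [IsDomain (X ⊗[k] Y)] (φ : A →ₐ[k] X) (χ : B →ₐ[k] Y) {p : Ideal A}
    {q : Ideal B} (hφ : ∀ a, φ a = 0 ↔ a ∈ p) (hχ : ∀ b, χ b = 0 ↔ b ∈ q) :
    (leftExt k B p ⊔ rightExt k A q).IsPrime := by
  have : leftExt k B p ⊔ rightExt k A q = RingHom.ker (Algebra.TensorProduct.map φ χ) := by
    ext f
    rw [← mem_sup_iff_map_eq_zero φ χ hφ hχ, RingHom.mem_ker]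
  rw [this]
  exact RingHom.ker_isPrime _

theorem sup_mem_minimalPrimes {I p : Ideal A} {J q : Ideal B} (hp : p ∈ I.minimalPrimes)
    (hq : q ∈ J.minimalPrimes) (h : (leftExt k B p ⊔ rightExt k A q).IsPrime) :
    leftExt k B p ⊔ rightExt k A q ∈ (leftExt k B I ⊔ rightExt k A J).minimalPrimes := by
  refine ⟨⟨h, sup_le_sup (Ideal.map_mono hp.1.2) (Ideal.map_mono hq.1.2)⟩, ?_⟩
  rintro Q ⟨hQ, hIJ⟩ hle
  obtain ⟨hI, hJ⟩ := sup_le_iff.mp hIJ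
  refine sup_le (Ideal.map_le_iff_le_comap.mpr (hp.2 ⟨hQ.comap _, Ideal.map_le_iff_le_comap.mp hI⟩
      fun a ha => (tmul_mem_sup (hle ha)).resolve_right hq.1.1.one_notMem))
    (Ideal.map_le_iff_le_comap.mpr (hq.2 ⟨hQ.comap _, Ideal.map_le_iff_le_comap.mp hJ⟩
      fun b hb => (tmul_mem_sup (hle hb)).resolve_left hp.1.1.one_notMem))

theorem exists_eq_sup_of_mem_minimalPrimes {I : Ideal A} {J : Ideal B}
    (h : ∀ p ∈ I.minimalPrimes, ∀ q ∈ J.minimalPrimes,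
      (leftExt k B p ⊔ rightExt k A q).IsPrime)
    {Q : Ideal (A ⊗[k] B)} (hQ : Q ∈ (leftExt k B I ⊔ rightExt k A J).minimalPrimes) :
    ∃ p ∈ I.minimalPrimes, ∃ q ∈ J.minimalPrimes, Q = leftExt k B p ⊔ rightExt k A q := by
  obtain ⟨⟨hQp, hIJ⟩, hmin⟩ := hQ
  obtain ⟨hI, hJ⟩ := sup_le_iff.mp hIJ
  have hQA := hQp.comap (Algebra.TensorProduct.includeLeft : A →ₐ[k] A ⊗[k] B)
  have hQB := hQp.comap (Algebra.TensorProduct.includeRight : B →ₐ[k] A ⊗[k] B)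
  obtain ⟨p, hp, hpQ⟩ := Ideal.exists_minimalPrimes_le (Ideal.map_le_iff_le_comap.mp hI)
  obtain ⟨q, hq, hqQ⟩ := Ideal.exists_minimalPrimes_le (Ideal.map_le_iff_le_comap.mp hJ)
  have hle : leftExt k B p ⊔ rightExt k A q ≤ Q :=
    sup_le (Ideal.map_le_iff_le_comap.mpr hpQ) (Ideal.map_le_iff_le_comap.mpr hqQ)
  exact ⟨p, hp, q, hq, le_antisymm
    (hmin ⟨h p hp q hq, sup_le_sup (Ideal.map_mono hp.1.2) (Ideal.map_mono hq.1.2)⟩ hle) hle⟩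

/-- Every minimal prime of `I` is the kernel of a homomorphism to a rational function field. -/
def HasRationalMinimalPrimes (k : Type*) [Field k] {A : Type*} [CommRing A] [Algebra k A]
    (I : Ideal A) : Prop :=
  ∀ p ∈ I.minimalPrimes, ∃ (σ : Type) (φ : A →ₐ[k] FractionRing (MvPolynomial σ k)),
    ∀ a, φ a = 0 ↔ a ∈ p

theorem HasRationalMinimalPrimes.isPrime_sup {I : Ideal A} {J : Ideal B}
    (hI : HasRationalMinimalPrimes k I) (hJ : HasRationalMinimalPrimes k J) :
    ∀ p ∈ I.minimalPrimes, ∀ q ∈ J.minimalPrimes,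
      (leftExt k B p ⊔ rightExt k A q).IsPrime := by
  intro p hp q hq
  obtain ⟨σ, φ, hφ⟩ := hI p hp
  obtain ⟨τ, χ, hχ⟩ := hJ q hq
  have := isDomain_fractionRing_mvPolynomial_tensor k σ (FractionRing (MvPolynomial τ k))
  exact _root_.isPrime_sup φ χ hφ hχ

/-- If the `n`-th symbolic and ordinary powers of a sum of ideals in independent variables agree, so
do the `t`-th powers of the left summand, provided `J ^ (n - t)` is not contained in the next
power of `J`. -/
theorem symbolicPower_eq_pow_of_sup {I : Ideal A} {J : Ideal B}
    (h : ∀ p ∈ I.minimalPrimes, ∀ q ∈ J.minimalPrimes,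
      (leftExt k B p ⊔ rightExt k A q).IsPrime) {n t : ℕ} (htn : t ≤ n)
    (hJ : ¬ J ^ (n - t) ≤ J ^ (n - t + 1))
    (hs : symbolicPower (leftExt k B I ⊔ rightExt k A J) n =
      (leftExt k B I ⊔ rightExt k A J) ^ n) :
    symbolicPower I t = I ^ t := by
  refine le_antisymm (fun f hf => ?_) (pow_le_symbolicPower I t)
  obtain ⟨g, hg, hg'⟩ := SetLike.not_le_iff_exists.mp hJ
  have hfg : f ⊗ₜ[k] g ∈ symbolicPower (leftExt k B I ⊔ rightExt k A J) n := by
    rw [mem_symbolicPower_iff] at hf ⊢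
    intro Q hQ
    obtain ⟨p, hp, q, hq, rfl⟩ := exists_eq_sup_of_mem_minimalPrimes h hQ
    obtain ⟨s, hs, hsf⟩ := hf p hp
    refine ⟨s ⊗ₜ 1, fun h => (tmul_mem_sup h).elim hs hq.1.1.one_notMem, ?_⟩
    have e : (s ⊗ₜ[k] (1 : B)) * (f ⊗ₜ g) = ((s * f) ⊗ₜ 1) * (1 ⊗ₜ g) := by simp
    rw [e]
    refine pow_mul_pow_le_sup_pow _ _ (Nat.add_sub_of_le htn) (Ideal.mul_mem_mul ?_ ?_)
    · rw [← Ideal.map_pow]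
      exact Ideal.mem_map_of_mem _ hsf
    · rw [← Ideal.map_pow]
      exact Ideal.mem_map_of_mem _ hg
  rw [hs] at hfg
  have := sup_pow_le_pow_sup_pow _ _ (show t + (n - t + 1) ≤ n + 1 by omega) hfg
  rw [← Ideal.map_pow, ← Ideal.map_pow] at this
  exact (tmul_mem_sup this).resolve_right hg'

theorem mem_nonZeroDivisors_of_map_residue_right {E D Ω : Type*} [CommRing D] [IsLocalRing D]
    [Algebra k D] [CommRing E] [Algebra k E] [Field Ω] [Algebra k Ω] (ψ : D →ₐ[k] Ω)
    [IsLocalHom ψ.toRingHom] (s : E ⊗[k] D)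
    (hs : Algebra.TensorProduct.map (AlgHom.id k E) ψ s ∈ nonZeroDivisors (E ⊗[k] Ω)) :
    s ∈ nonZeroDivisors (E ⊗[k] D) := by
  have key := mem_nonZeroDivisors_of_map_residue ψ (Algebra.TensorProduct.comm k E D s) (by
    have e : Algebra.TensorProduct.map ψ (AlgHom.id k E) (Algebra.TensorProduct.comm k E D s) =
        Algebra.TensorProduct.comm k E Ω (Algebra.TensorProduct.map (AlgHom.id k E) ψ s) := by
      clear hs
      induction s with
      | zero => simp
      | add x y hx hy => simp only [map_add, hx, hy]
      | tmul a b => simp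
    rw [e]
    exact (MulEquivClass.map_nonZeroDivisors (Algebra.TensorProduct.comm k E Ω)).le
      ⟨_, hs, rfl⟩)
  rw [← MulEquivClass.map_nonZeroDivisors (Algebra.TensorProduct.comm k E D)] at key
  obtain ⟨x, hx, hxs⟩ := key
  rwa [← (Algebra.TensorProduct.comm k E D).injective hxs]

/-- Symbolic powers of a sum of ideals in independent variables are bounded by sums of symbolic
powers: elements outside a minimal prime of the sum stay regular in the tensor product of the
corresponding local quotients. -/
theorem symbolicPower_sup_le {I : Ideal A} {J : Ideal B}
    (hI : HasRationalMinimalPrimes k I) (hJ : HasRationalMinimalPrimes k J) {n i j : ℕ}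
    (hi : i ≠ 0) (hj : j ≠ 0) (hij : i + j ≤ n + 1) :
    symbolicPower (leftExt k B I ⊔ rightExt k A J) n ≤
      leftExt k B (symbolicPower I i) ⊔ rightExt k A (symbolicPower J j) := by
  have hpr := hI.isPrime_sup hJ
  choose σ φ hφ using hI
  choose τ χ hχ using hJ
  intro f hf
  rw [mem_symbolicPower_iff] at hf
  have : ∀ p : I.minimalPrimes, p.1.IsPrime := fun p => p.2.1.1
  have : ∀ q : J.minimalPrimes, q.1.IsPrime := fun q => q.2.1.1
  let C := fun p : I.minimalPrimes =>
    Localization.AtPrime p.1 ⧸ (I ^ i).map (algebraMap A (Localization.AtPrime p.1))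
  let D := fun q : J.minimalPrimes =>
    Localization.AtPrime q.1 ⧸ (J ^ j).map (algebraMap B (Localization.AtPrime q.1))
  have hC := fun p : I.minimalPrimes =>
    exists_local_test p.2.1.1 p.2.1.2 hi (φ p.1 p.2) (hφ p.1 p.2)
  have hD := fun q : J.minimalPrimes =>
    exists_local_test q.2.1.1 q.2.1.2 hj (χ q.1 q.2) (hχ q.1 q.2)
  choose hC₁ ψ hψ hC₂ hC₃ using hC
  choose hD₁ θ hθ hD₂ hD₃ using hD
  let v := fun p => IsScalarTower.toAlgHom k A (C p)
  let w := fun q => IsScalarTower.toAlgHom k B (D q)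
  refine mem_sup_of_forall_map_eq_zero (fun p => (v p).toLinearMap) (fun q => (w q).toLinearMap)
    (fun a => ?_) (fun b => ?_) fun p q => ?_
  · rw [mem_symbolicPower_iff]
    exact ⟨fun h p => (hC₃ p a).mpr (h p.1 p.2), fun h p hp => (hC₃ ⟨p, hp⟩ a).mp (h ⟨p, hp⟩)⟩
  · rw [mem_symbolicPower_iff]
    exact ⟨fun h q => (hD₃ q b).mpr (h q.1 q.2), fun h q hq => (hD₃ ⟨q, hq⟩ b).mp (h ⟨q, hq⟩)⟩
  obtain ⟨s, hs, hsf⟩ := hf _ (sup_mem_minimalPrimes p.2 q.2 (hpr p.1 p.2 q.1 q.2))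
  let F := Algebra.TensorProduct.map (v p) (w q)
  have hdom := isDomain_fractionRing_mvPolynomial_tensor k (σ p.1 p.2)
    (FractionRing (MvPolynomial (τ q.1 q.2) k))
  have := hψ p
  have := hθ q
  have hcomp : Algebra.TensorProduct.map (AlgHom.id k _) (θ q)
      (Algebra.TensorProduct.map (ψ p) (AlgHom.id k (D q)) (F s)) =
      Algebra.TensorProduct.map (φ p.1 p.2) (χ q.1 q.2) s := by
    rw [← hC₂, ← hD₂]
    generalize s = x
    induction x with
    | zero => simp
    | add x y hx hy => simp only [map_add, hx, hy]
    | tmul a b => rfl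
  have hreg : F s ∈ nonZeroDivisors (C p ⊗[k] D q) := by
    refine mem_nonZeroDivisors_of_map_residue (ψ p) _
      (mem_nonZeroDivisors_of_map_residue_right (θ q) _ ?_)
    rw [hcomp, mem_nonZeroDivisors_iff_ne_zero]
    exact mt (mem_sup_iff_map_eq_zero _ _ (hφ p.1 p.2) (hχ q.1 q.2) s).mp hs
  have hker : leftExt k B (I ^ i) ⊔ rightExt k A (J ^ j) ≤ RingHom.ker F := by
    refine sup_le (Ideal.map_le_iff_le_comap.mpr fun a ha => ?_)
      (Ideal.map_le_iff_le_comap.mpr fun b hb => ?_)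
    · have h0 : v p a = 0 := (hC₃ p a).mpr ⟨1, p.2.1.1.one_notMem, by rwa [one_mul]⟩
      change v p a ⊗ₜ[k] w q 1 = 0
      rw [h0, zero_tmul]
    · have h0 : w q b = 0 := (hD₃ q b).mpr ⟨1, q.2.1.1.one_notMem, by rwa [one_mul]⟩
      change v p 1 ⊗ₜ[k] w q b = 0
      rw [h0, tmul_zero]
  have hzero : F (s * f) = 0 := by
    have h := sup_pow_le_pow_sup_pow _ _ hij hsf
    rw [← Ideal.map_pow, ← Ideal.map_pow] at h
    exact hker h
  rw [map_mul] at hzero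
  exact (mem_nonZeroDivisors_iff.mp hreg).1 _ hzero

theorem symbolicPower_sup_eq_pow {I : Ideal A} {J : Ideal B}
    (hI : HasRationalMinimalPrimes k I) (hJ : HasRationalMinimalPrimes k J) {n : ℕ} (hn : 1 ≤ n)
    (hIs : ∀ t ≤ n, symbolicPower I t = I ^ t) (hJs : ∀ t ≤ n, symbolicPower J t = J ^ t) :
    symbolicPower (leftExt k B I ⊔ rightExt k A J) n =
      (leftExt k B I ⊔ rightExt k A J) ^ n := by
  refine le_antisymm ?_ (pow_le_symbolicPower _ n)
  refine le_of_le_sup_chains (fun i => leftExt k B I ^ i) (fun j => rightExt k A J ^ j)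
    (fun _ _ h => Ideal.pow_le_pow_right h) (by simp) (by simp)
    (fun _ _ h => Ideal.pow_le_pow_right h) hn (fun i hi => ?_) fun i hi hin => ?_
  · refine le_trans ?_ (pow_mul_pow_le_sup_pow _ _ (Nat.add_sub_of_le hi))
    simp only [← Ideal.map_pow]
    exact map_includeLeft_inf_map_includeRight _ _
  · have h := symbolicPower_sup_le hI hJ (n := n) (i := i) (j := n + 1 - i) (by omega) (by omega)
      (by omega)
    rw [hIs i hin, hJs _ (by omega)] at h
    simpa only [leftExt, rightExt, ← Ideal.map_pow] using h

theorem symbolicPower_bot [IsDomain B] {t : ℕ} (ht : t ≠ 0) :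
    symbolicPower (⊥ : Ideal B) t = ⊥ := by
  refine eq_bot_iff.mpr fun f hf => ?_
  obtain ⟨s, hs, h⟩ := mem_symbolicPower_iff.mp hf ⊥
    ((IsDomain.minimalPrimes_eq_singleton_bot B).ge rfl)
  rw [Ideal.bot_pow ht, Ideal.mem_bot] at h
  exact (mul_eq_zero.mp h).resolve_left hs

theorem symbolicPower_leftExt_eq_pow_iff {I : Ideal A} (hI : HasRationalMinimalPrimes k I)
    [IsDomain B] (hB : HasRationalMinimalPrimes k (⊥ : Ideal B)) (t : ℕ) :
    symbolicPower (leftExt k B I) t = leftExt k B I ^ t ↔ symbolicPower I t = I ^ t := by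
  rcases eq_or_ne t 0 with rfl | ht
  · simp only [symbolicPower_zero]
  have hsup : leftExt k B I ⊔ rightExt k A (⊥ : Ideal B) = leftExt k B I := by
    rw [rightExt, Ideal.map_bot, sup_bot_eq]
  constructor
  · intro h
    refine symbolicPower_eq_pow_of_sup (J := (⊥ : Ideal B)) (hI.isPrime_sup hB) le_rfl (by simp) ?_
    rwa [hsup]
  · intro h
    refine le_antisymm ?_ (pow_le_symbolicPower _ t)
    have h1 := symbolicPower_sup_le hI hB ht one_ne_zero (le_refl (t + 1))
    rw [hsup, symbolicPower_bot one_ne_zero, h, rightExt, Ideal.map_bot, sup_bot_eq] at h1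
    rwa [← Ideal.map_pow]

theorem comap_comm_sup (I : Ideal A) (J : Ideal B) :
    (leftExt k A J ⊔ rightExt k B I).comap (Algebra.TensorProduct.comm k A B).toRingEquiv =
      leftExt k B I ⊔ rightExt k A J := by
  apply le_antisymm
  · rw [← Ideal.map_symm, Ideal.map_sup]
    refine sup_le ?_ ?_
    · refine Ideal.map_le_iff_le_comap.mpr (Ideal.map_le_iff_le_comap.mpr fun b hb => ?_)
      exact Ideal.mem_sup_right (Ideal.mem_map_of_mem _ hb)
    · refine Ideal.map_le_iff_le_comap.mpr (Ideal.map_le_iff_le_comap.mpr fun a ha => ?_)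
      exact Ideal.mem_sup_left (Ideal.mem_map_of_mem _ ha)
  · refine sup_le (Ideal.map_le_iff_le_comap.mpr fun a ha => ?_)
      (Ideal.map_le_iff_le_comap.mpr fun b hb => ?_)
    · exact Ideal.mem_sup_right (Ideal.mem_map_of_mem _ ha)
    · exact Ideal.mem_sup_left (Ideal.mem_map_of_mem _ hb)

theorem symbolicPower_rightExt_eq_pow_iff {J : Ideal B} (hJ : HasRationalMinimalPrimes k J)
    [IsDomain A] (hA : HasRationalMinimalPrimes k (⊥ : Ideal A)) (t : ℕ) :
    symbolicPower (rightExt k A J) t = rightExt k A J ^ t ↔ symbolicPower J t = J ^ t := by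
  have h := comap_comm_sup (k := k) (⊥ : Ideal A) J
  rw [leftExt, rightExt, leftExt, Ideal.map_bot, Ideal.map_bot, sup_bot_eq, bot_sup_eq] at h
  rw [← h, symbolicPower_eq_pow_comap_ringEquiv_iff]
  exact symbolicPower_leftExt_eq_pow_iff hJ hA t

/-- The equality of symbolic and ordinary powers of a sum of ideals in independent variables. -/
theorem symbolicPower_sup_eq_pow_iff {I : Ideal A} {J : Ideal B}
    (hI : HasRationalMinimalPrimes k I) (hJ : HasRationalMinimalPrimes k J) {n : ℕ} (hn : 1 ≤ n)
    (hIs : ∀ t ≤ n - 1, ¬ I ^ t ≤ I ^ (t + 1)) (hJs : ∀ t ≤ n - 1, ¬ J ^ t ≤ J ^ (t + 1)) :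
    symbolicPower (leftExt k B I ⊔ rightExt k A J) n = (leftExt k B I ⊔ rightExt k A J) ^ n ↔
      ∀ t ≤ n, symbolicPower I t = I ^ t ∧ symbolicPower J t = J ^ t := by
  refine ⟨fun h t ht => ?_, fun h => symbolicPower_sup_eq_pow hI hJ hn (fun t ht => (h t ht).1)
    fun t ht => (h t ht).2⟩
  rcases eq_or_ne t 0 with rfl | ht0
  · exact ⟨symbolicPower_zero I, symbolicPower_zero J⟩
  refine ⟨symbolicPower_eq_pow_of_sup (hI.isPrime_sup hJ) ht (hJs _ (by omega)) h,
    symbolicPower_eq_pow_of_sup (hJ.isPrime_sup hI) ht (hIs _ (by omega)) ?_⟩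
  rwa [← symbolicPower_eq_pow_comap_ringEquiv_iff (Algebra.TensorProduct.comm k A B).toRingEquiv,
    comap_comm_sup]

end TensorProduct

theorem hasRationalMinimalPrimes_bot (k σ : Type) [Field k] :
    HasRationalMinimalPrimes k (⊥ : Ideal (MvPolynomial σ k)) := by
  intro p hp
  have hp' : p = ⊥ := (IsDomain.minimalPrimes_eq_singleton_bot (MvPolynomial σ k)).le hp
  subst hp'
  refine ⟨σ, IsScalarTower.toAlgHom k (MvPolynomial σ k) (FractionRing (MvPolynomial σ k)),
    fun a => ?_⟩
  rw [IsScalarTower.coe_toAlgHom', Ideal.mem_bot]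
  exact map_eq_zero_iff _ (IsFractionRing.injective _ _)

/-- The relation on `V` of having proportional coordinate vectors `(a i, b i)`, `(a j, b j)`. -/
def proportionalSetoid {V F : Type*} [Field F] (a b : V → F) : Setoid V where
  r i j := ∃ c : Fˣ, a i = c * a j ∧ b i = c * b j
  iseqv :=
    { refl := fun i => ⟨1, by simp, by simp⟩
      symm := by
        rintro i j ⟨c, ha, hb⟩
        exact ⟨c⁻¹, by simp [ha], by simp [hb]⟩
      trans := by
        rintro i j l ⟨c, ha, hb⟩ ⟨d, ha', hb'⟩
        exact ⟨c * d, by simp [ha, ha', mul_assoc], by simp [hb, hb', mul_assoc]⟩ }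

theorem exists_unit_of_det_eq_zero {F : Type*} [Field F] {a b c d : F} (h : a * d = c * b)
    (hab : ¬(a = 0 ∧ b = 0)) (hcd : ¬(c = 0 ∧ d = 0)) :
    ∃ u : Fˣ, a = u * c ∧ b = u * d := by
  by_cases hc : c = 0
  · have hd : d ≠ 0 := fun hd => hcd ⟨hc, hd⟩
    have ha : a = 0 := by
      rw [hc, zero_mul] at h
      exact (mul_eq_zero.mp h).resolve_right hd
    have hb : b ≠ 0 := fun hb => hab ⟨ha, hb⟩
    exact ⟨Units.mk0 (b / d) (div_ne_zero hb hd), by simp [ha, hc], by simp [hd]⟩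
  · have ha : a ≠ 0 := fun ha => hab ⟨ha, by
      rw [ha, zero_mul] at h
      exact (mul_eq_zero.mp h.symm).resolve_left hc⟩
    exact ⟨Units.mk0 (a / c) (div_ne_zero ha hc), by simp [hc], by
      rw [Units.val_mk0]; field_simp; rw [h]; ring⟩

/-- The minimal primes of a binomial edge ideal are kernels of homomorphisms to rational function
fields: the coordinate vector of a vertex is sent either to zero or to a free multiple of a generic
vector attached to its proportionality class. -/
theorem hasRationalMinimalPrimes_binomialEdgeIdeal (k : Type) [Field k] {V : Type}
    (G : SimpleGraph V) : HasRationalMinimalPrimes k (binomialEdgeIdeal k G) := by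
  classical
  intro p hp
  have hprime : p.IsPrime := hp.1.1
  let F := FractionRing (MvPolynomial (V ⊕ V) k ⧸ p)
  let π : MvPolynomial (V ⊕ V) k →ₐ[k] F :=
    (IsScalarTower.toAlgHom k (MvPolynomial (V ⊕ V) k ⧸ p) F).comp (Ideal.Quotient.mkₐ k p)
  have hπ : ∀ f, π f = 0 ↔ f ∈ p := fun f => by
    rw [← Ideal.Quotient.eq_zero_iff_mem]
    exact map_eq_zero_iff _ (IsFractionRing.injective (MvPolynomial (V ⊕ V) k ⧸ p) F)
  let a : V → F := fun i => π (X (Sum.inl i))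
  let b : V → F := fun i => π (X (Sum.inr i))
  let r := proportionalSetoid a b
  let σ := V ⊕ (Quotient r ⊕ Quotient r)
  let x : V → MvPolynomial σ k := fun i =>
    if a i = 0 ∧ b i = 0 then 0 else
      X (Sum.inl i) * X (Sum.inr (Sum.inl (Quotient.mk r i)))
  let y : V → MvPolynomial σ k := fun i =>
    if a i = 0 ∧ b i = 0 then 0 else
      X (Sum.inl i) * X (Sum.inr (Sum.inr (Quotient.mk r i)))
  let φ : MvPolynomial (V ⊕ V) k →ₐ[k] MvPolynomial σ k := aeval (Sum.elim x y)
  have hout : ∀ i, ∃ c : Fˣ, a i = c * a (Quotient.mk r i).out ∧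
      b i = c * b (Quotient.mk r i).out :=
    fun i => r.symm (Quotient.mk_out i)
  choose c hca hcb using hout
  let ψ : MvPolynomial σ k →ₐ[k] F :=
    aeval (Sum.elim (fun i => (c i : F)) (Sum.elim (fun q => a q.out) fun q => b q.out))
  have hψφ : ψ.comp φ = π := by
    ext (i | i)
    · by_cases h : a i = 0 ∧ b i = 0
      · refine Eq.trans ?_ h.1.symm
        simp [φ, x, h]
      · simpa [φ, ψ, x, h] using (hca i).symm
    · by_cases h : a i = 0 ∧ b i = 0
      · refine Eq.trans ?_ h.2.symm
        simp [φ, y, h]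
      · simpa [φ, ψ, y, h] using (hcb i).symm
  have hker : RingHom.ker φ ≤ p := fun f hf => by
    rw [← hπ, ← hψφ, AlgHom.comp_apply, (RingHom.mem_ker).mp hf, map_zero]
  have hle : binomialEdgeIdeal k G ≤ RingHom.ker φ := by
    refine Ideal.span_le.mpr ?_
    rintro _ ⟨i, j, hij, rfl⟩
    have hdet : a i * b j = a j * b i := by
      have := (hπ _).mpr (hp.1.2 (Ideal.subset_span ⟨i, j, hij, rfl⟩))
      rw [map_sub, map_mul, map_mul] at this
      exact sub_eq_zero.mp this
    change φ _ = 0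
    by_cases hi : a i = 0 ∧ b i = 0
    · simp [φ, x, y, hi]
    by_cases hj : a j = 0 ∧ b j = 0
    · simp [φ, x, y, hj]
    have hq : Quotient.mk r i = Quotient.mk r j :=
      Quotient.sound (exists_unit_of_det_eq_zero hdet hi hj)
    simp only [φ, x, y, hi, hj, hq, map_sub, map_mul, aeval_X, Sum.elim_inl, Sum.elim_inr, if_false]
    ring
  have heq : RingHom.ker φ = p := le_antisymm hker (hp.2 ⟨RingHom.ker_isPrime φ, hle⟩ hker)
  refine ⟨σ, (IsScalarTower.toAlgHom k (MvPolynomial σ k)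
    (FractionRing (MvPolynomial σ k))).comp φ, fun f => ?_⟩
  rw [← heq, RingHom.mem_ker]
  exact map_eq_zero_iff _ (IsFractionRing.injective (MvPolynomial σ k) _)

/-- The polynomial ring of a disjoint union of vertex sets as a tensor product. -/
noncomputable def sumTensorEquiv (k : Type) [Field k] (V₁ V₂ : Type) :
    MvPolynomial (V₁ ⊕ V₁) k ⊗[k] MvPolynomial (V₂ ⊕ V₂) k ≃ₐ[k]
      MvPolynomial ((V₁ ⊕ V₂) ⊕ (V₁ ⊕ V₂)) k :=
  (tensorEquivSum k (V₁ ⊕ V₁) (V₂ ⊕ V₂) k).trans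
    (renameEquiv k (Equiv.sumSumSumComm V₁ V₁ V₂ V₂))

section

variable {V₁ V₂ : Type} (k : Type) [Field k]

theorem sumTensorEquiv_X_tmul_one (i : V₁ ⊕ V₁) :
    sumTensorEquiv k V₁ V₂ (X i ⊗ₜ 1) = X (Sum.map Sum.inl Sum.inl i) := by
  rcases i with i | i <;> simp [sumTensorEquiv]

theorem sumTensorEquiv_one_tmul_X (i : V₂ ⊕ V₂) :
    sumTensorEquiv k V₁ V₂ (1 ⊗ₜ X i) = X (Sum.map Sum.inr Sum.inr i) := by
  rcases i with i | i <;> simp [sumTensorEquiv]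

theorem comap_binomialEdgeIdeal_sumLeft (G₁ : SimpleGraph V₁) :
    (binomialEdgeIdeal k (sumLeft V₂ G₁)).comap (sumTensorEquiv k V₁ V₂).toRingEquiv =
      leftExt k (MvPolynomial (V₂ ⊕ V₂) k) (binomialEdgeIdeal k G₁) := by
  have key : ∀ i j : V₁, (sumTensorEquiv k V₁ V₂).toRingEquiv
      ((X (Sum.inl i) * X (Sum.inr j) - X (Sum.inl j) * X (Sum.inr i)) ⊗ₜ 1) =
      X (Sum.inl (Sum.inl i)) * X (Sum.inr (Sum.inl j)) -
        X (Sum.inl (Sum.inl j)) * X (Sum.inr (Sum.inl i)) := fun i j => by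
    have e : ∀ f g : MvPolynomial (V₁ ⊕ V₁) k, (f * g) ⊗ₜ[k] (1 : MvPolynomial (V₂ ⊕ V₂) k) =
      (f ⊗ₜ 1) * (g ⊗ₜ 1) := by simp
    rw [sub_tmul, e, e, map_sub, map_mul, map_mul]
    simp [sumTensorEquiv_X_tmul_one]
  apply le_antisymm
  · rw [← Ideal.map_symm, Ideal.map_le_iff_le_comap]
    refine Ideal.span_le.mpr ?_
    rintro _ ⟨i, j, hij, rfl⟩
    have mem : ∀ i j, G₁.Adj i j →
        (X (Sum.inl (Sum.inl i)) * X (Sum.inr (Sum.inl j)) -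
          X (Sum.inl (Sum.inl j)) * X (Sum.inr (Sum.inl i)) :
            MvPolynomial ((V₁ ⊕ V₂) ⊕ (V₁ ⊕ V₂)) k) ∈
        (leftExt k (MvPolynomial (V₂ ⊕ V₂) k) (binomialEdgeIdeal k G₁)).comap
          (sumTensorEquiv k V₁ V₂).toRingEquiv.symm := fun i j h => by
      rw [Ideal.mem_comap, ← key, RingEquiv.symm_apply_apply]
      exact Ideal.mem_map_of_mem _ (Ideal.subset_span ⟨i, j, h, rfl⟩)
    rcases ((SimpleGraph.fromRel_adj _ _ _).mp hij).2 with
      ⟨a, b, hab, rfl, rfl⟩ | ⟨a, b, hab, rfl, rfl⟩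
    · exact mem a b hab
    · exact mem b a hab.symm
  · refine Ideal.map_le_iff_le_comap.mpr (Ideal.span_le.mpr ?_)
    rintro _ ⟨i, j, hij, rfl⟩
    refine Ideal.subset_span ⟨Sum.inl i, Sum.inl j, ?_, key i j⟩
    exact (SimpleGraph.fromRel_adj _ _ _).mpr
      ⟨fun h => hij.ne (Sum.inl_injective h), Or.inl ⟨i, j, hij, rfl, rfl⟩⟩

theorem comap_binomialEdgeIdeal_sumRight (G₂ : SimpleGraph V₂) :
    (binomialEdgeIdeal k (sumRight V₁ G₂)).comap (sumTensorEquiv k V₁ V₂).toRingEquiv =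
      rightExt k (MvPolynomial (V₁ ⊕ V₁) k) (binomialEdgeIdeal k G₂) := by
  have key : ∀ i j : V₂, (sumTensorEquiv k V₁ V₂).toRingEquiv
      (1 ⊗ₜ (X (Sum.inl i) * X (Sum.inr j) - X (Sum.inl j) * X (Sum.inr i))) =
      X (Sum.inl (Sum.inr i)) * X (Sum.inr (Sum.inr j)) -
        X (Sum.inl (Sum.inr j)) * X (Sum.inr (Sum.inr i)) := fun i j => by
    have e : ∀ f g : MvPolynomial (V₂ ⊕ V₂) k, (1 : MvPolynomial (V₁ ⊕ V₁) k) ⊗ₜ[k] (f * g) =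
      (1 ⊗ₜ f) * (1 ⊗ₜ g) := by simp
    rw [tmul_sub, e, e, map_sub, map_mul, map_mul]
    simp [sumTensorEquiv_one_tmul_X]
  apply le_antisymm
  · rw [← Ideal.map_symm, Ideal.map_le_iff_le_comap]
    refine Ideal.span_le.mpr ?_
    rintro _ ⟨i, j, hij, rfl⟩
    have mem : ∀ i j, G₂.Adj i j →
        (X (Sum.inl (Sum.inr i)) * X (Sum.inr (Sum.inr j)) -
          X (Sum.inl (Sum.inr j)) * X (Sum.inr (Sum.inr i)) :
            MvPolynomial ((V₁ ⊕ V₂) ⊕ (V₁ ⊕ V₂)) k) ∈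
        (rightExt k (MvPolynomial (V₁ ⊕ V₁) k) (binomialEdgeIdeal k G₂)).comap
          (sumTensorEquiv k V₁ V₂).toRingEquiv.symm := fun i j h => by
      rw [Ideal.mem_comap, ← key, RingEquiv.symm_apply_apply]
      exact Ideal.mem_map_of_mem _ (Ideal.subset_span ⟨i, j, h, rfl⟩)
    rcases ((SimpleGraph.fromRel_adj _ _ _).mp hij).2 with
      ⟨a, b, hab, rfl, rfl⟩ | ⟨a, b, hab, rfl, rfl⟩
    · exact mem a b hab
    · exact mem b a hab.symm
  · refine Ideal.map_le_iff_le_comap.mpr (Ideal.span_le.mpr ?_)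
    rintro _ ⟨i, j, hij, rfl⟩
    refine Ideal.subset_span ⟨Sum.inr i, Sum.inr j, ?_, key i j⟩
    exact (SimpleGraph.fromRel_adj _ _ _).mpr
      ⟨fun h => hij.ne (Sum.inr_injective h), Or.inl ⟨i, j, hij, rfl, rfl⟩⟩

end

/-- Let `G₁`, `G₂` be graphs on disjoint vertex sets, and let `I = J_{G₁}`, `J = J_{G₂}` be
their binomial edge ideals in the common polynomial ring with variables `x_v, y_v` for
`v ∈ V₁ ⊕ V₂` (so `I` and `J` involve disjoint sets of variables). Fix `n ≥ 1` and assume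
`I ^ t ≠ I ^ (t + 1)` and `J ^ t ≠ J ^ (t + 1)` for every `t ≤ n - 1`. Then
`(I + J) ^ (n) = (I + J) ^ n` iff `I ^ (t) = I ^ t` and `J ^ (t) = J ^ t` for all `t ≤ n`. -/
theorem sum_symbolic_eq_ordinary_iff {V₁ V₂ : Type} (k : Type) [Field k]
    (G₁ : SimpleGraph V₁) (G₂ : SimpleGraph V₂) (n : ℕ) (hn : 1 ≤ n)
    (hI : ∀ t : ℕ, t ≤ n - 1 →
      binomialEdgeIdeal k (sumLeft V₂ G₁) ^ t ≠ binomialEdgeIdeal k (sumLeft V₂ G₁) ^ (t + 1))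
    (hJ : ∀ t : ℕ, t ≤ n - 1 →
      binomialEdgeIdeal k (sumRight V₁ G₂) ^ t ≠
        binomialEdgeIdeal k (sumRight V₁ G₂) ^ (t + 1)) :
    symbolicPower (binomialEdgeIdeal k (sumLeft V₂ G₁) + binomialEdgeIdeal k (sumRight V₁ G₂)) n
        = (binomialEdgeIdeal k (sumLeft V₂ G₁) + binomialEdgeIdeal k (sumRight V₁ G₂)) ^ n ↔
      ∀ t : ℕ, t ≤ n →
        symbolicPower (binomialEdgeIdeal k (sumLeft V₂ G₁)) t =
            binomialEdgeIdeal k (sumLeft V₂ G₁) ^ t ∧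
          symbolicPower (binomialEdgeIdeal k (sumRight V₁ G₂)) t =
            binomialEdgeIdeal k (sumRight V₁ G₂) ^ t := by
  let e := (sumTensorEquiv k V₁ V₂).toRingEquiv
  have hL := comap_binomialEdgeIdeal_sumLeft (V₂ := V₂) k G₁
  have hR := comap_binomialEdgeIdeal_sumRight (V₁ := V₁) k G₂
  have hcomap : Function.Injective (Ideal.comap e) :=
    Ideal.comap_injective_of_surjective e e.surjective
  have hsup : (binomialEdgeIdeal k (sumLeft V₂ G₁) + binomialEdgeIdeal k (sumRight V₁ G₂)).comap e =
      leftExt k _ (binomialEdgeIdeal k G₁) ⊔ rightExt k _ (binomialEdgeIdeal k G₂) := by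
    rw [← hL, ← hR, ← Ideal.map_symm, ← Ideal.map_symm, ← Ideal.map_symm, Ideal.add_eq_sup,
      Ideal.map_sup]
  have hI₁ := hasRationalMinimalPrimes_binomialEdgeIdeal k G₁
  have hJ₂ := hasRationalMinimalPrimes_binomialEdgeIdeal k G₂
  have hI' : ∀ t ≤ n - 1, ¬binomialEdgeIdeal k G₁ ^ t ≤ binomialEdgeIdeal k G₁ ^ (t + 1) :=
    fun t ht h => hI t ht <| hcomap <| by
      rw [← comap_pow_ringEquiv, ← comap_pow_ringEquiv, hL, ← Ideal.map_pow, ← Ideal.map_pow,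
        h.antisymm (Ideal.pow_le_pow_right t.le_succ)]
  have hJ' : ∀ t ≤ n - 1, ¬binomialEdgeIdeal k G₂ ^ t ≤ binomialEdgeIdeal k G₂ ^ (t + 1) :=
    fun t ht h => hJ t ht <| hcomap <| by
      rw [← comap_pow_ringEquiv, ← comap_pow_ringEquiv, hR, ← Ideal.map_pow, ← Ideal.map_pow,
        h.antisymm (Ideal.pow_le_pow_right t.le_succ)]
  rw [← symbolicPower_eq_pow_comap_ringEquiv_iff e, hsup,
    symbolicPower_sup_eq_pow_iff hI₁ hJ₂ hn hI' hJ']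
  refine forall₂_congr fun t _ => and_congr ?_ ?_
  · rw [← symbolicPower_eq_pow_comap_ringEquiv_iff e, hL,
      symbolicPower_leftExt_eq_pow_iff hI₁ (hasRationalMinimalPrimes_bot k _)]
  · rw [← symbolicPower_eq_pow_comap_ringEquiv_iff e, hR,
      symbolicPower_rightExt_eq_pow_iff hJ₂ (hasRationalMinimalPrimes_bot k _)]
end
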